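/- arXiv:2202.08232 — 5 statements merged into one kernel-verified Lean document; each statement's English description precedes it below -/
import Mathlib

section
/- Let f_1,…,f_m, N_1,…,N_m, s, c be a local model, let (x^{(1)},y^{(1)}),…,(x^{(n)},y^{(n)}) be a dataset with loss L, and let Θ : [0,∞) → ℝ^p be a gradient flow trajectory of L. Then for every t ≥ 0 and every j ∈ {1,…,p}, the j-th coordinate θ_j(t) of Θ(t) satisfies |θ_j'(t)| ≤ s·c·√(2·L(Θ(0)) / m). -/
open Real MeasureTheory ProbabilityTheory

/-- Partial derivative of `g : ℝ^p → ℝ` with respect to the `j`-th coordinate. -/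
noncomputable def pder {p : ℕ} (j : Fin p) (g : (Fin p → ℝ) → ℝ) (Θ : Fin p → ℝ) : ℝ :=
  fderiv ℝ g Θ (Pi.single j 1)

/-- The model function `f(Θ,x) = m^{-1/2} ∑_k f_k(Θ,x)`. -/
noncomputable def modelF {m p d : ℕ} (f : Fin m → (Fin p → ℝ) → (Fin d → ℝ) → ℝ)
    (Θ : Fin p → ℝ) (x : Fin d → ℝ) : ℝ :=
  (Real.sqrt m)⁻¹ * ∑ k, f k Θ x

/-- The tangent kernel `K_Θ(x,x') = ∑_j ∂_{θ_j} f(Θ,x) ⬝ ∂_{θ_j} f(Θ,x')`. -/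
noncomputable def kernelK {m p d : ℕ} (f : Fin m → (Fin p → ℝ) → (Fin d → ℝ) → ℝ)
    (Θ : Fin p → ℝ) (x x' : Fin d → ℝ) : ℝ :=
  ∑ j : Fin p, pder j (fun Θ' => modelF f Θ' x) Θ * pder j (fun Θ' => modelF f Θ' x') Θ

/-- A local model: each `f_k` is C², depends only on the parameters in `N k`,
`|N k| ≤ s`, each parameter appears in at most `s` of the `N k`'s, and all first and
second partial derivatives of the `f_k` are bounded by `c`. -/
def IsLocalModel {m p d : ℕ} (f : Fin m → (Fin p → ℝ) → (Fin d → ℝ) → ℝ)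
    (N : Fin m → Finset (Fin p)) (s c : ℝ) : Prop :=
  (∀ k x, ContDiff ℝ 2 fun Θ => f k Θ x) ∧
  (∀ k x (Θ Θ' : Fin p → ℝ), (∀ j ∈ N k, Θ j = Θ' j) → f k Θ x = f k Θ' x) ∧
  (∀ k, ((N k).card : ℝ) ≤ s) ∧
  (∀ j : Fin p, ((Finset.univ.filter fun k => j ∈ N k).card : ℝ) ≤ s) ∧
  (∀ k j Θ x, |pder j (fun Θ' => f k Θ' x) Θ| ≤ c) ∧
  (∀ k i j Θ x, |pder i (fun Θ' => pder j (fun Θ'' => f k Θ'' x) Θ') Θ| ≤ c)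

/-- The mean squared error loss `L(Θ) = (1/n) ∑_i ½(f(Θ,x⁽ⁱ⁾) − y⁽ⁱ⁾)²`. -/
noncomputable def lossL {m p d n : ℕ} (f : Fin m → (Fin p → ℝ) → (Fin d → ℝ) → ℝ)
    (X : Fin n → Fin d → ℝ) (Y : Fin n → ℝ) (Θ : Fin p → ℝ) : ℝ :=
  (n : ℝ)⁻¹ * ∑ i, (1 / 2) * (modelF f Θ (X i) - Y i) ^ 2

theorem pder_eq_zero_of_notMem {p : ℕ} {g : (Fin p → ℝ) → ℝ} {S : Finset (Fin p)}
    (hg : Differentiable ℝ g) (hS : ∀ Θ Θ' : Fin p → ℝ, (∀ j ∈ S, Θ j = Θ' j) → g Θ = g Θ')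
    {j : Fin p} (hj : j ∉ S) (Θ : Fin p → ℝ) : pder j g Θ = 0 := by
  have h1 : HasLineDerivAt ℝ g (fderiv ℝ g Θ (Pi.single j 1)) Θ (Pi.single j 1) :=
    (hg Θ).hasFDerivAt.hasLineDerivAt _
  have h2 : HasLineDerivAt ℝ g 0 Θ (Pi.single j 1) := by
    have h3 : (fun t : ℝ => g (Θ + t • Pi.single j 1)) = fun _ => g Θ := by
      funext t
      refine hS _ _ fun i hi => ?_
      have hij : i ≠ j := fun h => hj (h ▸ hi)
      simp [hij]
    unfold HasLineDerivAt
    rw [h3]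
    exact hasDerivAt_const _ _
  exact h1.unique h2

theorem pder_modelF {m p d : ℕ} {f : Fin m → (Fin p → ℝ) → (Fin d → ℝ) → ℝ} {x : Fin d → ℝ}
    (hf : ∀ k, Differentiable ℝ fun Θ => f k Θ x) (j : Fin p) (Θ : Fin p → ℝ) :
    pder j (fun Θ' => modelF f Θ' x) Θ
      = (Real.sqrt m)⁻¹ * ∑ k, pder j (fun Θ' => f k Θ' x) Θ := by
  have h : HasFDerivAt (fun Θ' => modelF f Θ' x)
      ((Real.sqrt m)⁻¹ • ∑ k, fderiv ℝ (fun Θ' => f k Θ' x) Θ) Θ :=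
    (HasFDerivAt.fun_sum fun k _ => (hf k Θ).hasFDerivAt).const_mul _
  simp [pder, h.fderiv]

theorem differentiable_modelF {m p d : ℕ} {f : Fin m → (Fin p → ℝ) → (Fin d → ℝ) → ℝ}
    {x : Fin d → ℝ} (hf : ∀ k, Differentiable ℝ fun Θ => f k Θ x) :
    Differentiable ℝ fun Θ => modelF f Θ x :=
  (Differentiable.fun_sum fun k _ => hf k).const_mul _

theorem hasFDerivAt_lossL {m p d n : ℕ} {f : Fin m → (Fin p → ℝ) → (Fin d → ℝ) → ℝ}
    (hf : ∀ k x, Differentiable ℝ fun Θ => f k Θ x) (X : Fin n → Fin d → ℝ) (Y : Fin n → ℝ)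
    (Θ : Fin p → ℝ) :
    HasFDerivAt (lossL f X Y) ((n : ℝ)⁻¹ • ∑ i, (modelF f Θ (X i) - Y i) •
      fderiv ℝ (fun Θ' => modelF f Θ' (X i)) Θ) Θ := by
  refine (HasFDerivAt.fun_sum fun i _ => ?_).const_mul _
  have h := ((((differentiable_modelF fun k => hf k (X i)) Θ).hasFDerivAt.sub_const
    (Y i)).pow 2).const_mul (1 / 2 : ℝ)
  refine h.congr_fderiv ?_
  rw [smul_smul]
  congr 1
  simp

/-- The loss is nonincreasing along its gradient flow. -/
theorem lossL_le_of_gradient_flow {m p d n : ℕ}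
    {f : Fin m → (Fin p → ℝ) → (Fin d → ℝ) → ℝ}
    (hf : ∀ k x, Differentiable ℝ fun Θ => f k Θ x) (X : Fin n → Fin d → ℝ) (Y : Fin n → ℝ)
    {Θ : ℝ → Fin p → ℝ}
    (hflow : ∀ t : ℝ, 0 ≤ t → ∀ j : Fin p,
      HasDerivAt (fun u => Θ u j) (-(pder j (lossL f X Y) (Θ t))) t) {t : ℝ} (ht : 0 ≤ t) :
    lossL f X Y (Θ t) ≤ lossL f X Y (Θ 0) := by
  have hder : ∀ u : ℝ, 0 ≤ u → HasDerivAt (fun v => lossL f X Y (Θ v))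
      (-∑ j, pder j (lossL f X Y) (Θ u) ^ 2) u := by
    intro u hu
    have h := (hasFDerivAt_lossL hf X Y (Θ u)).differentiableAt.hasFDerivAt.comp_hasDerivAt u
      (hasDerivAt_pi.2 (hflow u hu))
    refine h.congr_deriv ?_
    rw [← Finset.univ_sum_single (fun j => -pder j (lossL f X Y) (Θ u)), map_sum,
      ← Finset.sum_neg_distrib]
    refine Finset.sum_congr rfl fun j _ => ?_
    have hs : (Pi.single j (-pder j (lossL f X Y) (Θ u)) : Fin p → ℝ)
        = (-pder j (lossL f X Y) (Θ u)) • Pi.single j 1 := by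
      rw [← Pi.single_smul]; simp
    rw [hs, map_smul, smul_eq_mul, ← pder]
    ring
  have hanti : AntitoneOn (fun v => lossL f X Y (Θ v)) (Set.Ici 0) := by
    refine antitoneOn_of_deriv_nonpos (convex_Ici 0)
      (fun u hu => (hder u hu).continuousAt.continuousWithinAt) ?_ ?_
    · intro u hu
      rw [interior_Ici] at hu
      exact (hder u (le_of_lt hu)).differentiableAt.differentiableWithinAt
    · intro u hu
      rw [interior_Ici] at hu
      rw [(hder u (le_of_lt hu)).deriv]
      exact neg_nonpos.2 (Finset.sum_nonneg fun j _ => sq_nonneg _)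
  exact hanti Set.self_mem_Ici ht ht

theorem IsLocalModel.differentiable {m p d : ℕ} {f : Fin m → (Fin p → ℝ) → (Fin d → ℝ) → ℝ}
    {N : Fin m → Finset (Fin p)} {s c : ℝ} (hloc : IsLocalModel f N s c) (k : Fin m)
    (x : Fin d → ℝ) : Differentiable ℝ fun Θ => f k Θ x :=
  (hloc.1 k x).differentiable (by norm_num)

theorem IsLocalModel.abs_pder_modelF_le {m p d : ℕ}
    {f : Fin m → (Fin p → ℝ) → (Fin d → ℝ) → ℝ} {N : Fin m → Finset (Fin p)} {s c : ℝ}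
    (hloc : IsLocalModel f N s c) (hc : 0 ≤ c) (j : Fin p) (Θ : Fin p → ℝ) (x : Fin d → ℝ) :
    |pder j (fun Θ' => modelF f Θ' x) Θ| ≤ s * c / Real.sqrt m := by
  rw [pder_modelF (fun k => hloc.differentiable k x), abs_mul,
    abs_of_nonneg (inv_nonneg.2 (Real.sqrt_nonneg _)), div_eq_inv_mul]
  refine mul_le_mul_of_nonneg_left ?_ (inv_nonneg.2 (Real.sqrt_nonneg _))
  calc |∑ k, pder j (fun Θ' => f k Θ' x) Θ|
      = |∑ k with j ∈ N k, pder j (fun Θ' => f k Θ' x) Θ| := by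
        rw [Finset.sum_filter_of_ne]
        intro k _ hk
        by_contra hj
        exact hk (pder_eq_zero_of_notMem (hloc.differentiable k x) (hloc.2.1 k x) hj Θ)
    _ ≤ ∑ k with j ∈ N k, |pder j (fun Θ' => f k Θ' x) Θ| := Finset.abs_sum_le_sum_abs _ _
    _ ≤ ∑ k with j ∈ N k, c := Finset.sum_le_sum fun k _ => hloc.2.2.2.2.1 k j Θ x
    _ = ((Finset.univ.filter fun k => j ∈ N k).card : ℝ) * c := by simp
    _ ≤ s * c := mul_le_mul_of_nonneg_right (hloc.2.2.2.1 j) hc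

/-- Cauchy–Schwarz: the mean absolute residual is at most `√(2L)`. -/
theorem mean_abs_residual_le_sqrt_lossL {m p d n : ℕ}
    (f : Fin m → (Fin p → ℝ) → (Fin d → ℝ) → ℝ) (X : Fin n → Fin d → ℝ) (Y : Fin n → ℝ)
    (Θ : Fin p → ℝ) :
    (n : ℝ)⁻¹ * ∑ i, |modelF f Θ (X i) - Y i| ≤ Real.sqrt (2 * lossL f X Y Θ) := by
  refine Real.le_sqrt_of_sq_le ?_
  have hcs := sq_sum_le_card_mul_sum_sq (s := Finset.univ)
    (f := fun i => |modelF f Θ (X i) - Y i|)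
  simp only [sq_abs, Finset.card_univ, Fintype.card_fin] at hcs
  rw [lossL, ← Finset.mul_sum, mul_pow]
  rcases Nat.eq_zero_or_pos n with rfl | hn
  · simp
  have hn' : (n : ℝ) ≠ 0 := by positivity
  calc (n : ℝ)⁻¹ ^ 2 * (∑ i, |modelF f Θ (X i) - Y i|) ^ 2
      ≤ (n : ℝ)⁻¹ ^ 2 * (n * ∑ i, (modelF f Θ (X i) - Y i) ^ 2) := by gcongr
    _ = 2 * ((n : ℝ)⁻¹ * (1 / 2 * ∑ i, (modelF f Θ (X i) - Y i) ^ 2)) := by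
      field_simp

theorem IsLocalModel.abs_pder_lossL_le {m p d n : ℕ}
    {f : Fin m → (Fin p → ℝ) → (Fin d → ℝ) → ℝ} {N : Fin m → Finset (Fin p)} {s c : ℝ}
    (hloc : IsLocalModel f N s c) (hs : 0 ≤ s) (hc : 0 ≤ c) (X : Fin n → Fin d → ℝ)
    (Y : Fin n → ℝ) (j : Fin p) (Θ : Fin p → ℝ) :
    |pder j (lossL f X Y) Θ| ≤ s * c / Real.sqrt m * Real.sqrt (2 * lossL f X Y Θ) := by
  have hL : pder j (lossL f X Y) Θ = (n : ℝ)⁻¹ * ∑ i, (modelF f Θ (X i) - Y i) *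
      pder j (fun Θ' => modelF f Θ' (X i)) Θ := by
    simp [pder, (hasFDerivAt_lossL hloc.differentiable X Y Θ).fderiv]
  rw [hL, abs_mul, abs_of_nonneg (by positivity : (0 : ℝ) ≤ (n : ℝ)⁻¹)]
  calc (n : ℝ)⁻¹ * |∑ i, (modelF f Θ (X i) - Y i) * pder j (fun Θ' => modelF f Θ' (X i)) Θ|
      ≤ (n : ℝ)⁻¹ * ∑ i, |modelF f Θ (X i) - Y i| * (s * c / Real.sqrt m) := by
        refine mul_le_mul_of_nonneg_left ((Finset.abs_sum_le_sum_abs _ _).trans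
          (Finset.sum_le_sum fun i _ => ?_)) (by positivity)
        rw [abs_mul]
        exact mul_le_mul_of_nonneg_left (hloc.abs_pder_modelF_le hc j Θ (X i)) (abs_nonneg _)
    _ = s * c / Real.sqrt m * ((n : ℝ)⁻¹ * ∑ i, |modelF f Θ (X i) - Y i|) := by
        rw [← Finset.sum_mul]; ring
    _ ≤ s * c / Real.sqrt m * Real.sqrt (2 * lossL f X Y Θ) :=
        mul_le_mul_of_nonneg_left (mean_abs_residual_le_sqrt_lossL f X Y Θ) (by positivity)

/-- Along a gradient flow trajectory of the loss of a local model, each parameter moves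
with speed at most `s·c·√(2L(Θ(0))/m)`. -/
theorem gradient_flow_parameter_speed_bound
    {m p d n : ℕ} (hm : 1 ≤ m) (hp : 1 ≤ p) (hd : 1 ≤ d) {s c : ℝ} (hs : 1 ≤ s) (hc : 0 < c)
    (f : Fin m → (Fin p → ℝ) → (Fin d → ℝ) → ℝ) (N : Fin m → Finset (Fin p))
    (hloc : IsLocalModel f N s c)
    (X : Fin n → Fin d → ℝ) (Y : Fin n → ℝ)
    (Θ : ℝ → Fin p → ℝ)
    (hflow : ∀ t : ℝ, 0 ≤ t → ∀ j : Fin p,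
      HasDerivAt (fun u => Θ u j) (-(pder j (lossL f X Y) (Θ t))) t) :
    ∀ t : ℝ, 0 ≤ t → ∀ j : Fin p,
      |deriv (fun u => Θ u j) t| ≤ s * c * Real.sqrt (2 * lossL f X Y (Θ 0) / m) := by
  intro t ht j
  rw [(hflow t ht j).deriv, abs_neg, Real.sqrt_div' _ (Nat.cast_nonneg m), ← mul_div_assoc,
    mul_div_right_comm]
  have hs0 : 0 ≤ s := zero_le_one.trans hs
  refine (hloc.abs_pder_lossL_le hs0 hc.le X Y j (Θ t)).trans ?_
  have hmono := lossL_le_of_gradient_flow hloc.differentiable X Y hflow ht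
  gcongr
end

section
/- Let f_1,…,f_m, N_1,…,N_m, s, c be a local model, let (x^{(1)},y^{(1)}),…,(x^{(n)},y^{(n)}) be a dataset with loss L, let Θ : [0,∞) → ℝ^p be a gradient flow trajectory of L, and let Θ̄ be the gradient flow trajectory of the linearized loss L̄ with Θ̄(0) = Θ(0). Then for all t ≥ 0, |L(Θ(t)) − L̄(Θ̄(t))| ≤ 4·√2·s⁴·c³·L(Θ(0))^{3/2}·t² / √m. -/
open Real MeasureTheory ProbabilityTheory

/-- The linearization of the model at `Θ₀`:
`f̄(Θ̄,x) = f(Θ₀,x) + ∇_Θ f(Θ₀,x) ⬝ (Θ̄ − Θ₀)`. -/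
noncomputable def linF {m p d : ℕ} (f : Fin m → (Fin p → ℝ) → (Fin d → ℝ) → ℝ)
    (Θ₀ Θbar : Fin p → ℝ) (x : Fin d → ℝ) : ℝ :=
  modelF f Θ₀ x + ∑ j : Fin p, pder j (fun Θ' => modelF f Θ' x) Θ₀ * (Θbar j - Θ₀ j)

/-- The loss of the linearized model. -/
noncomputable def linLoss {m p d n : ℕ} (f : Fin m → (Fin p → ℝ) → (Fin d → ℝ) → ℝ)
    (Θ₀ : Fin p → ℝ) (X : Fin n → Fin d → ℝ) (Y : Fin n → ℝ) (Θbar : Fin p → ℝ) : ℝ :=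
  (n : ℝ)⁻¹ * ∑ i, (1 / 2) * (linF f Θ₀ Θbar (X i) - Y i) ^ 2

/-- The root mean squared deviation between the model along `Θ` and the linearized model
along `Θbar`. -/
noncomputable def devΔ {m p d n : ℕ} (f : Fin m → (Fin p → ℝ) → (Fin d → ℝ) → ℝ)
    (X : Fin n → Fin d → ℝ) (Θ Θbar : ℝ → Fin p → ℝ) (t : ℝ) : ℝ :=
  Real.sqrt ((n : ℝ)⁻¹ * ∑ i, (modelF f (Θ t) (X i) - linF f (Θ 0) (Θbar t) (X i)) ^ 2)

/-- A function on `[0, ∞)` with nonpositive derivative stays below its initial value. -/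
lemma le_initial_of_hasDerivAt_nonpos {h h' : ℝ → ℝ}
    (hd : ∀ t, 0 ≤ t → HasDerivAt h (h' t) t) (hn : ∀ t, 0 ≤ t → h' t ≤ 0) {t : ℝ} (ht : 0 ≤ t) :
    h t ≤ h 0 := by
  have : AntitoneOn h (Set.Ici 0) := by
    refine antitoneOn_of_deriv_nonpos (convex_Ici 0)
      (fun x hx => (hd x hx).continuousAt.continuousWithinAt) ?_ ?_
    · intro x hx
      rw [interior_Ici] at hx
      exact (hd x (le_of_lt hx)).differentiableAt.differentiableWithinAt
    · intro x hx
      rw [interior_Ici] at hx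
      rw [(hd x (le_of_lt hx)).deriv]
      exact hn x (le_of_lt hx)
  exact this Set.self_mem_Ici ht ht

/-- If `q ≥ 0` vanishes at `0` and `q' ≤ 4 a t √q`, then `√q ≤ a t²`. -/
lemma sqrt_le_of_deriv_le {q q' : ℝ → ℝ} {a : ℝ}
    (hq : ∀ t, 0 ≤ q t) (h0 : q 0 = 0) (ha : 0 ≤ a)
    (hd : ∀ t, 0 ≤ t → HasDerivAt q (q' t) t)
    (hb : ∀ t, 0 ≤ t → q' t ≤ 4 * a * t * √(q t)) {t : ℝ} (ht : 0 ≤ t) :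
    √(q t) ≤ a * t ^ 2 := by
  refine le_of_forall_pos_le_add fun ε hε => ?_
  have hpos : ∀ t, 0 < q t + ε ^ 2 := fun t => by have := hq t; positivity
  have key := le_initial_of_hasDerivAt_nonpos (h := fun t => √(q t + ε ^ 2) - a * t ^ 2)
    (h' := fun t => q' t / (2 * √(q t + ε ^ 2)) - a * (2 * t))
    (fun t ht => by
      refine HasDerivAt.sub (((hd t ht).add_const _).sqrt (hpos t).ne') ?_
      simpa using (hasDerivAt_pow 2 t).const_mul a)
    (fun t ht => by
      have hs : 0 < √(q t + ε ^ 2) := Real.sqrt_pos.2 (hpos t)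
      have h1 : √(q t) ≤ √(q t + ε ^ 2) := Real.sqrt_le_sqrt (by nlinarith [sq_nonneg ε])
      have h2 := hb t ht
      have h3 : 4 * a * t * √(q t) ≤ 4 * a * t * √(q t + ε ^ 2) := by gcongr
      rw [sub_nonpos, div_le_iff₀ (by positivity)]
      linarith) ht
  simp only [h0, zero_add, Real.sqrt_sq hε.le] at key
  have : √(q t) ≤ √(q t + ε ^ 2) := Real.sqrt_le_sqrt (by nlinarith [sq_nonneg ε])
  norm_num at key
  linarith

/-- Cauchy–Schwarz for averages of scaled bounded vectors. -/
lemma norm_average_smul_le {E : Type*} [NormedAddCommGroup E] [NormedSpace ℝ E] {n : ℕ}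
    (a : Fin n → ℝ) (u : Fin n → E) {U : ℝ} (hU : 0 ≤ U) (hu : ∀ i, ‖u i‖ ≤ U) :
    ‖(n : ℝ)⁻¹ • ∑ i, a i • u i‖ ≤ U * √((n : ℝ)⁻¹ * ∑ i, a i ^ 2) := by
  have hw : (0 : ℝ) ≤ (n : ℝ)⁻¹ := by positivity
  have h1 : ‖(n : ℝ)⁻¹ • ∑ i, a i • u i‖ ≤ (n : ℝ)⁻¹ * ∑ i, |a i| * U := by
    rw [norm_smul, Real.norm_of_nonneg hw]
    gcongr
    refine (norm_sum_le _ _).trans (Finset.sum_le_sum fun i _ => ?_)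
    rw [norm_smul, Real.norm_eq_abs]
    gcongr
    exact hu i
  refine h1.trans ?_
  rw [← Finset.sum_mul, ← mul_assoc, mul_comm]
  gcongr
  apply Real.le_sqrt_of_sq_le
  have h2 : (∑ i, |a i|) ^ 2 ≤ n * ∑ i, a i ^ 2 := by
    simpa using sq_sum_le_card_mul_sum_sq (s := (Finset.univ : Finset (Fin n))) (f := fun i => |a i|)
  rcases Nat.eq_zero_or_pos n with rfl | hn
  · simp
  · have hn' : (n : ℝ) ≠ 0 := by positivity
    calc ((n : ℝ)⁻¹ * ∑ i, |a i|) ^ 2 = (n : ℝ)⁻¹ ^ 2 * (∑ i, |a i|) ^ 2 := by ring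
      _ ≤ (n : ℝ)⁻¹ ^ 2 * (n * ∑ i, a i ^ 2) := by gcongr
      _ = _ := by field_simp

lemma abs_average_mul_le {n : ℕ} (a b : Fin n → ℝ) :
    |(n : ℝ)⁻¹ * ∑ i, a i * b i| ≤
      √((n : ℝ)⁻¹ * ∑ i, a i ^ 2) * √((n : ℝ)⁻¹ * ∑ i, b i ^ 2) := by
  have hw : (0 : ℝ) ≤ (n : ℝ)⁻¹ := by positivity
  rw [← Real.sqrt_mul (mul_nonneg hw (Finset.sum_nonneg fun i _ => sq_nonneg _))]
  apply Real.abs_le_sqrt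
  have := Finset.sum_mul_sq_le_sq_mul_sq Finset.univ a b
  calc ((n : ℝ)⁻¹ * ∑ i, a i * b i) ^ 2 = (n : ℝ)⁻¹ ^ 2 * (∑ i, a i * b i) ^ 2 := by ring
    _ ≤ (n : ℝ)⁻¹ ^ 2 * ((∑ i, a i ^ 2) * ∑ i, b i ^ 2) := by gcongr
    _ = _ := by ring

/-- Comparison of the residuals `r` of a gradient flow with feature vectors `g` to the residuals
`ρ` of the flow with the features frozen at time `0`. -/
lemma abs_sub_le_of_residual_flow {E : Type*} [NormedAddCommGroup E] [InnerProductSpace ℝ E]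
    {n : ℕ} {g g' : Fin n → ℝ → E} {r ρ : Fin n → ℝ → ℝ} {v w : ℝ → E} {G B : ℝ}
    (hG : 0 ≤ G) (hB : 0 ≤ B)
    (hv : ∀ t, v t = -((n : ℝ)⁻¹ • ∑ i, r i t • g i t))
    (hw : ∀ t, w t = -((n : ℝ)⁻¹ • ∑ i, ρ i t • g i 0))
    (hr : ∀ t, 0 ≤ t → ∀ i, HasDerivAt (r i) (inner ℝ (g i t) (v t)) t)
    (hρ : ∀ t, 0 ≤ t → ∀ i, HasDerivAt (ρ i) (inner ℝ (g i 0) (w t)) t)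
    (h0 : ∀ i, ρ i 0 = r i 0)
    (hgG : ∀ t i, ‖g i t‖ ≤ G)
    (hg : ∀ t, 0 ≤ t → ∀ i, HasDerivAt (g i) (g' i t) t)
    (hg' : ∀ t, 0 ≤ t → ∀ i, ‖g' i t‖ ≤ B * ‖v t‖) {t : ℝ} (ht : 0 ≤ t) :
    |(n : ℝ)⁻¹ * ∑ i, r i t ^ 2 - (n : ℝ)⁻¹ * ∑ i, ρ i t ^ 2| ≤
      2 * (B * G ^ 2) * ((n : ℝ)⁻¹ * ∑ i, r i 0 ^ 2) *
        √((n : ℝ)⁻¹ * ∑ i, r i 0 ^ 2) * t ^ 2 := by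
  set R := (n : ℝ)⁻¹ * ∑ i, r i 0 ^ 2 with hR
  have hn : (0 : ℝ) ≤ (n : ℝ)⁻¹ := by positivity
  have hR0 : 0 ≤ R := mul_nonneg hn (Finset.sum_nonneg fun i _ => sq_nonneg _)
  have inner_avg : ∀ (a : Fin n → ℝ) (u : Fin n → E) (z : E),
      (n : ℝ)⁻¹ * ∑ i, a i * inner ℝ (u i) z = inner ℝ ((n : ℝ)⁻¹ • ∑ i, a i • u i) z := by
    intro a u z
    simp [inner_smul_left, sum_inner]
  have mono : ∀ (a : Fin n → ℝ → ℝ) (u : Fin n → ℝ → E) (z : ℝ → E),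
      (∀ t, z t = -((n : ℝ)⁻¹ • ∑ i, a i t • u i t)) →
      (∀ t, 0 ≤ t → ∀ i, HasDerivAt (a i) (inner ℝ (u i t) (z t)) t) → ∀ t, 0 ≤ t →
      (n : ℝ)⁻¹ * ∑ i, a i t ^ 2 ≤ (n : ℝ)⁻¹ * ∑ i, a i 0 ^ 2 := by
    intro a u z hz ha t ht
    refine le_initial_of_hasDerivAt_nonpos (h := fun t => (n : ℝ)⁻¹ * ∑ i, a i t ^ 2)
      (h' := fun t => (n : ℝ)⁻¹ * ∑ i, 2 * a i t * inner ℝ (u i t) (z t)) ?_ ?_ ht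
    · intro t ht
      refine HasDerivAt.const_mul _ (HasDerivAt.fun_sum fun i _ => ?_)
      simpa using (ha t ht i).fun_pow 2
    · intro t _
      rw [inner_avg, show (n : ℝ)⁻¹ • ∑ i, (2 * a i t) • u i t = -((2 : ℝ) • z t) by
        rw [hz]; simp [Finset.smul_sum, smul_smul, mul_left_comm]]
      rw [inner_neg_left, inner_smul_left, real_inner_self_eq_norm_sq]
      simp
  have hrR := mono r g v hv hr
  have hρR : ∀ t, 0 ≤ t → (n : ℝ)⁻¹ * ∑ i, ρ i t ^ 2 ≤ R := by
    intro t ht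
    have := mono ρ (fun i _ => g i 0) w hw hρ t ht
    simpa [h0] using this
  have hvR : ∀ t, 0 ≤ t → ‖v t‖ ≤ G * √R := by
    intro t ht
    rw [hv, norm_neg]
    refine (norm_average_smul_le _ _ hG (hgG t)).trans ?_
    gcongr
    exact hrR t ht
  have hgd : ∀ t, 0 ≤ t → ∀ i, ‖g i t - g i 0‖ ≤ B * (G * √R) * t := by
    intro t ht i
    have := norm_image_sub_le_of_norm_deriv_le_segment' (f := g i) (f' := g' i) (a := 0) (b := t)
      (C := B * (G * √R)) (fun x hx => (hg x hx.1 i).hasDerivWithinAt)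
      (fun x hx => (hg' x hx.1 i).trans (by gcongr; exact hvR x hx.1)) t ⟨ht, le_rfl⟩
    simpa using this
  have hdev : ∀ t, 0 ≤ t →
      √((n : ℝ)⁻¹ * ∑ i, (r i t - ρ i t) ^ 2) ≤ B * G ^ 2 * R * t ^ 2 := by
    intro t ht
    refine sqrt_le_of_deriv_le (q := fun t => (n : ℝ)⁻¹ * ∑ i, (r i t - ρ i t) ^ 2)
      (q' := fun t => (n : ℝ)⁻¹ * ∑ i, 2 * (r i t - ρ i t) *
        (inner ℝ (g i t) (v t) - inner ℝ (g i 0) (w t)))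
      (fun t => mul_nonneg hn (Finset.sum_nonneg fun i _ => sq_nonneg _))
      (by simp [h0]) (by positivity) ?_ ?_ ht
    · intro t ht
      refine HasDerivAt.const_mul _ (HasDerivAt.fun_sum fun i _ => ?_)
      simpa using ((hr t ht i).fun_sub (hρ t ht i)).fun_pow 2
    · intro t ht
      set Δ := √((n : ℝ)⁻¹ * ∑ i, (r i t - ρ i t) ^ 2)
      set P := (n : ℝ)⁻¹ • ∑ i, (r i t - ρ i t) • g i 0 with hP
      set Q := (n : ℝ)⁻¹ • ∑ i, (r i t - ρ i t) • (g i t - g i 0) with hQ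
      set S := (n : ℝ)⁻¹ • ∑ i, r i t • (g i t - g i 0) with hS
      have hvw : v t - w t = -S - P := by
        rw [hv, hw, hS, hP]
        simp only [smul_sub, sub_smul, Finset.sum_sub_distrib]
        abel
      have e : (n : ℝ)⁻¹ * ∑ i, 2 * (r i t - ρ i t) *
          (inner ℝ (g i t) (v t) - inner ℝ (g i 0) (w t)) =
          2 * (inner ℝ Q (v t) + inner ℝ P (v t - w t)) := by
        rw [hQ, hP, ← inner_avg, ← inner_avg, ← mul_add, ← Finset.sum_add_distrib,
          mul_left_comm 2, Finset.mul_sum (a := (2 : ℝ))]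
        congr 1
        refine Finset.sum_congr rfl fun i _ => ?_
        rw [inner_sub_left, inner_sub_right]
        ring
      have hQn : ‖Q‖ ≤ B * (G * √R) * t * Δ :=
        norm_average_smul_le _ _ (by positivity) (hgd t ht)
      have hPn : ‖P‖ ≤ G * Δ := norm_average_smul_le _ _ hG (hgG 0)
      have hSn : ‖S‖ ≤ B * (G * √R) * t * √R := by
        refine (norm_average_smul_le _ _ (by positivity) (hgd t ht)).trans ?_
        gcongr
        exact hrR t ht
      have hPP : 0 ≤ inner ℝ P P := real_inner_self_nonneg
      have h1 : inner ℝ Q (v t) ≤ (B * (G * √R) * t * Δ) * (G * √R) :=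
        (real_inner_le_norm _ _).trans (by gcongr; exact hvR t ht)
      have h2 : -inner ℝ P S ≤ (G * Δ) * (B * (G * √R) * t * √R) := by
        rw [← inner_neg_right]
        refine (real_inner_le_norm _ _).trans ?_
        rw [norm_neg]
        gcongr
      have h3 := Real.mul_self_sqrt hR0
      rw [e, hvw, inner_sub_right, inner_neg_right]
      calc _ ≤ 2 * ((B * (G * √R) * t * Δ) * (G * √R) + (G * Δ) * (B * (G * √R) * t * √R)) := by
              linarith
        _ = 4 * (B * G ^ 2 * (√R * √R)) * t * Δ := by ring
        _ = _ := by rw [h3]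
  have hsum : √((n : ℝ)⁻¹ * ∑ i, (r i t + ρ i t) ^ 2) ≤ 2 * √R := by
    rw [show (2 : ℝ) * √R = √(2 ^ 2 * R) by
      rw [Real.sqrt_mul (x := (2 : ℝ) ^ 2) (by norm_num), Real.sqrt_sq (by norm_num)]]
    apply Real.sqrt_le_sqrt
    have : (n : ℝ)⁻¹ * ∑ i, (r i t + ρ i t) ^ 2 ≤
        (n : ℝ)⁻¹ * ∑ i, (2 * r i t ^ 2 + 2 * ρ i t ^ 2) := by
      gcongr with i
      nlinarith [sq_nonneg (r i t - ρ i t)]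
    rw [Finset.sum_add_distrib, ← Finset.mul_sum, ← Finset.mul_sum] at this
    linarith [hrR t ht, hρR t ht]
  have hfac : (n : ℝ)⁻¹ * ∑ i, r i t ^ 2 - (n : ℝ)⁻¹ * ∑ i, ρ i t ^ 2 =
      (n : ℝ)⁻¹ * ∑ i, (r i t - ρ i t) * (r i t + ρ i t) := by
    rw [← mul_sub, ← Finset.sum_sub_distrib]
    congr 1
    exact Finset.sum_congr rfl fun i _ => by ring
  rw [hfac]
  calc _ ≤ (B * G ^ 2 * R * t ^ 2) * (2 * √R) :=
        (abs_average_mul_le _ _).trans (mul_le_mul (hdev t ht) hsum (by positivity) (by positivity))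
    _ = _ := by ring

lemma pder_eq_zero_of_invariant {p : ℕ} {g : (Fin p → ℝ) → ℝ} {i : Fin p}
    (h : ∀ Θ (a : ℝ), g (Θ + a • Pi.single i 1) = g Θ) (Θ : Fin p → ℝ) : pder i g Θ = 0 := by
  unfold pder
  by_cases hd : DifferentiableAt ℝ g Θ
  · rw [← hd.lineDeriv_eq_fderiv]
    simp [lineDeriv, h]
  · simp [fderiv_zero_of_not_differentiableAt hd]

lemma pder_invariant {p : ℕ} {g : (Fin p → ℝ) → ℝ} {z : Fin p → ℝ}
    (h : ∀ Θ, g (Θ + z) = g Θ) (j : Fin p) (Θ : Fin p → ℝ) :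
    pder j g (Θ + z) = pder j g Θ := by
  unfold pder
  rw [← fderiv_comp_add_right, funext h]

lemma fderiv_apply_eq_sum_pder {p : ℕ} (g : (Fin p → ℝ) → ℝ) (Θ v : Fin p → ℝ) :
    fderiv ℝ g Θ v = ∑ j, v j * pder j g Θ := by
  conv_lhs => rw [pi_eq_sum_univ' v]
  simp [pder, map_sum]

/-- Chain rule along a curve, in coordinates. -/
lemma hasDerivAt_comp_curve {p : ℕ} {g : (Fin p → ℝ) → ℝ} {γ : ℝ → Fin p → ℝ} {v : Fin p → ℝ}
    {t : ℝ} (hg : DifferentiableAt ℝ g (γ t)) (hγ : ∀ j, HasDerivAt (fun u => γ u j) (v j) t) :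
    HasDerivAt (fun u => g (γ u)) (∑ j, v j * pder j g (γ t)) t := by
  rw [← fderiv_apply_eq_sum_pder]
  exact hg.hasFDerivAt.comp_hasDerivAt t (hasDerivAt_pi.2 hγ)

lemma differentiable_pder {p : ℕ} {g : (Fin p → ℝ) → ℝ} (hg : ContDiff ℝ 2 g) (j : Fin p) :
    Differentiable ℝ (pder j g) :=
  ((hg.fderiv_right (m := 1) (by norm_num)).differentiable (by norm_num)).clm_apply
    (differentiable_const _)

lemma pder_const_mul_sum {ι : Type*} [Fintype ι] {p : ℕ} {g : ι → (Fin p → ℝ) → ℝ}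
    (hg : ∀ k, Differentiable ℝ (g k)) (a : ℝ) (j : Fin p) (Θ : Fin p → ℝ) :
    pder j (fun Θ => a * ∑ k, g k Θ) Θ = a * ∑ k, pder j (g k) Θ := by
  have h := (HasFDerivAt.fun_sum (u := Finset.univ)
    fun k _ => (hg k Θ).hasFDerivAt).const_mul a
  unfold pder
  rw [h.fderiv]
  simp

lemma pder_half_mean_sq {p n : ℕ} {g : Fin n → (Fin p → ℝ) → ℝ}
    (hg : ∀ i, Differentiable ℝ (g i)) (Y : Fin n → ℝ) (j : Fin p) (Θ : Fin p → ℝ) :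
    pder j (fun Θ => (n : ℝ)⁻¹ * ∑ i, (1 / 2) * (g i Θ - Y i) ^ 2) Θ =
      (n : ℝ)⁻¹ * ∑ i, (g i Θ - Y i) * pder j (g i) Θ := by
  rw [pder_const_mul_sum (g := fun i Θ => (1 / 2) * (g i Θ - Y i) ^ 2)
    (fun i => (((hg i).sub_const _).pow 2).const_mul _)]
  congr 1
  refine Finset.sum_congr rfl fun i _ => ?_
  have h := (((hg i Θ).hasFDerivAt.sub_const (Y i)).pow 2).const_mul (1 / 2)
  unfold pder
  rw [h.fderiv]
  simp
  ring

/-- If each column of `a` is supported on at most `s` rows, squared column sums are controlled. -/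
lemma sum_sq_sum_le_of_support {m p : ℕ} {N : Fin m → Finset (Fin p)} {s : ℝ}
    (hN : ∀ j : Fin p, ((Finset.univ.filter fun k => j ∈ N k).card : ℝ) ≤ s)
    {a : Fin m → Fin p → ℝ} (ha : ∀ k j, j ∉ N k → a k j = 0) :
    ∑ j, (∑ k, a k j) ^ 2 ≤ s * ∑ k, ∑ j ∈ N k, a k j ^ 2 := by
  have h1 : ∀ j, (∑ k, a k j) ^ 2 ≤ s * ∑ k, a k j ^ 2 := by
    intro j
    rw [← Finset.sum_filter_of_ne (p := fun k => j ∈ N k)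
      (fun k _ hk => by by_contra h; exact hk (ha k j h))]
    refine sq_sum_le_card_mul_sum_sq.trans (mul_le_mul (hN j) ?_
      (Finset.sum_nonneg fun _ _ => sq_nonneg _) ((Nat.cast_nonneg _).trans (hN j)))
    exact Finset.sum_le_sum_of_subset_of_nonneg (Finset.filter_subset _ _)
      fun _ _ _ => sq_nonneg _
  refine (Finset.sum_le_sum fun j _ => h1 j).trans (le_of_eq ?_)
  rw [← Finset.mul_sum, Finset.sum_comm]
  congr 1
  refine Finset.sum_congr rfl fun k _ => (Finset.sum_subset (Finset.subset_univ _) ?_).symm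
  intro j _ hj
  simp [ha k j hj]

namespace IsLocalModel

variable {m p d : ℕ} {f : Fin m → (Fin p → ℝ) → (Fin d → ℝ) → ℝ} {N : Fin m → Finset (Fin p)}
  {s c : ℝ}

lemma contDiff_modelF (h : IsLocalModel f N s c) (x : Fin d → ℝ) :
    ContDiff ℝ 2 fun Θ => modelF f Θ x :=
  contDiff_const.mul (ContDiff.sum fun k _ => h.1 k x)

lemma apply_add_single (h : IsLocalModel f N s c) {k : Fin m} {j : Fin p} (hj : j ∉ N k)
    (x : Fin d → ℝ) (Θ : Fin p → ℝ) (a : ℝ) : f k (Θ + a • Pi.single j 1) x = f k Θ x := by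
  refine h.2.1 k x _ _ fun i hi => ?_
  have : i ≠ j := fun e => hj (e ▸ hi)
  simp [this]

lemma pder_modelF (h : IsLocalModel f N s c) (x : Fin d → ℝ) (j : Fin p) :
    pder j (fun Θ => modelF f Θ x) =
      fun Θ => (√m)⁻¹ * ∑ k, pder j (fun Θ => f k Θ x) Θ :=
  funext fun Θ => pder_const_mul_sum (fun k => (h.1 k x).differentiable (by norm_num)) _ _ _

/-- The squared gradient norm of a local model is at most `(s c)²`. -/
lemma sum_sq_pder_le (h : IsLocalModel f N s c) (hm : 1 ≤ m) (hs : 1 ≤ s)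
    (x : Fin d → ℝ) (Θ : Fin p → ℝ) :
    ∑ j, pder j (fun Θ => modelF f Θ x) Θ ^ 2 ≤ (s * c) ^ 2 := by
  have hm' : (0 : ℝ) < m := by exact_mod_cast hm
  have key := sum_sq_sum_le_of_support h.2.2.2.1
    (a := fun k j => pder j (fun Θ => f k Θ x) Θ)
    (fun k j hj => pder_eq_zero_of_invariant (fun Θ a => h.apply_add_single hj x Θ a) Θ)
  have h1 : ∀ k, ∑ j ∈ N k, pder j (fun Θ => f k Θ x) Θ ^ 2 ≤ s * c ^ 2 := by
    intro k
    refine (Finset.sum_le_card_nsmul _ _ (c ^ 2)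
      fun j _ => sq_le_sq' (abs_le.1 (h.2.2.2.2.1 k j Θ x)).1
        (abs_le.1 (h.2.2.2.2.1 k j Θ x)).2).trans ?_
    rw [nsmul_eq_mul]
    gcongr
    exact h.2.2.1 k
  have h2 : ∑ k, ∑ j ∈ N k, pder j (fun Θ => f k Θ x) Θ ^ 2 ≤ m * (s * c ^ 2) := by
    refine (Finset.sum_le_sum fun k _ => h1 k).trans ?_
    simp
  simp_rw [h.pder_modelF, mul_pow, ← Finset.mul_sum, inv_pow, Real.sq_sqrt hm'.le]
  rw [inv_mul_le_iff₀ hm']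
  calc _ ≤ s * (m * (s * c ^ 2)) := key.trans (by gcongr)
    _ = _ := by ring

/-- The Hessian of a local model has operator norm at most `s² c / √m`. -/
lemma sum_sq_pder_pder_le (h : IsLocalModel f N s c) (hm : 1 ≤ m) (hs : 1 ≤ s)
    (x : Fin d → ℝ) (Θ v : Fin p → ℝ) :
    ∑ j, (∑ i, v i * pder i (pder j fun Θ => modelF f Θ x) Θ) ^ 2 ≤
      (s ^ 2 * c / √m) ^ 2 * ∑ i, v i ^ 2 := by
  have hm' : (0 : ℝ) < m := by exact_mod_cast hm
  set H : Fin m → Fin p → Fin p → ℝ := fun k i j => pder i (pder j fun Θ => f k Θ x) Θ with hH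
  have hzero : ∀ k i j, i ∉ N k → H k i j = 0 := fun k i j hi =>
    pder_eq_zero_of_invariant (fun Θ a =>
      pder_invariant (fun Θ => h.apply_add_single hi x Θ a) j Θ) Θ
  have hzero' : ∀ k i j, j ∉ N k → H k i j = 0 := by
    intro k i j hj
    have : (pder j fun Θ => f k Θ x) = fun _ => 0 := funext fun Θ =>
      pder_eq_zero_of_invariant (fun Θ a => h.apply_add_single hj x Θ a) Θ
    simp [hH, this, pder]
  have key := sum_sq_sum_le_of_support h.2.2.2.1 (a := fun k j => ∑ i ∈ N k, v i * H k i j)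
    (fun k j hj => by simp [hzero' k _ j hj])
  have h1 : ∀ k j, (∑ i ∈ N k, v i * H k i j) ^ 2 ≤ s * c ^ 2 * ∑ i ∈ N k, v i ^ 2 := by
    intro k j
    have : ∑ i ∈ N k, H k i j ^ 2 ≤ s * c ^ 2 := by
      refine (Finset.sum_le_card_nsmul _ _ (c ^ 2)
        fun i _ => sq_le_sq' (abs_le.1 (h.2.2.2.2.2 k i j Θ x)).1
          (abs_le.1 (h.2.2.2.2.2 k i j Θ x)).2).trans ?_
      rw [nsmul_eq_mul]
      gcongr
      exact h.2.2.1 k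
    refine (Finset.sum_mul_sq_le_sq_mul_sq _ _ _).trans ?_
    rw [mul_comm]
    gcongr
  have h2 : ∀ k, ∑ j ∈ N k, (∑ i ∈ N k, v i * H k i j) ^ 2 ≤
      s * (s * c ^ 2 * ∑ i ∈ N k, v i ^ 2) := by
    intro k
    refine (Finset.sum_le_card_nsmul _ _ _ fun j _ => h1 k j).trans ?_
    rw [nsmul_eq_mul]
    gcongr
    exact h.2.2.1 k
  have h3 : ∑ k, ∑ i ∈ N k, v i ^ 2 ≤ s * ∑ i, v i ^ 2 := by
    rw [Finset.sum_comm' (t' := Finset.univ) (s' := fun i => Finset.univ.filter fun k => i ∈ N k)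
      (by simp), Finset.mul_sum]
    refine Finset.sum_le_sum fun i _ => ?_
    rw [Finset.sum_const, nsmul_eq_mul]
    gcongr
    exact h.2.2.2.1 i
  have hrw : ∀ j, ∑ i, v i * pder i (pder j fun Θ => modelF f Θ x) Θ =
      (√m)⁻¹ * ∑ k, ∑ i ∈ N k, v i * H k i j := by
    intro j
    simp_rw [h.pder_modelF, pder_const_mul_sum
      (fun k => differentiable_pder (h.1 k x) j), mul_left_comm _ (√m)⁻¹, ← Finset.mul_sum]
    congr 1
    simp_rw [Finset.mul_sum]
    rw [Finset.sum_comm]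
    refine Finset.sum_congr rfl fun k _ => (Finset.sum_subset (Finset.subset_univ _) ?_).symm
    intro i _ hi
    exact mul_eq_zero_of_right _ (hzero k i j hi)
  simp_rw [hrw, mul_pow, ← Finset.mul_sum, inv_pow, div_pow, Real.sq_sqrt hm'.le]
  rw [inv_mul_le_iff₀ hm']
  calc _ ≤ s * ∑ k, s * (s * c ^ 2 * ∑ i ∈ N k, v i ^ 2) :=
        key.trans (by gcongr with k; exact h2 k)
    _ = s ^ 3 * c ^ 2 * ∑ k, ∑ i ∈ N k, v i ^ 2 := by
        simp_rw [← Finset.mul_sum]; ring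
    _ ≤ s ^ 3 * c ^ 2 * (s * ∑ i, v i ^ 2) := by gcongr
    _ = _ := by field_simp

end IsLocalModel

lemma hasFDerivAt_linF {m p d : ℕ} (f : Fin m → (Fin p → ℝ) → (Fin d → ℝ) → ℝ)
    (Θ₀ Θ : Fin p → ℝ) (x : Fin d → ℝ) :
    HasFDerivAt (fun Θ => linF f Θ₀ Θ x)
      (∑ j, pder j (fun Θ' => modelF f Θ' x) Θ₀ •
        ContinuousLinearMap.proj (R := ℝ) (φ := fun _ : Fin p => ℝ) j) Θ := by
  refine HasFDerivAt.const_add _ (HasFDerivAt.fun_sum fun j _ => ?_)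
  exact ((hasFDerivAt_apply j Θ).sub_const _).const_mul _

lemma pder_linF {m p d : ℕ} (f : Fin m → (Fin p → ℝ) → (Fin d → ℝ) → ℝ)
    (Θ₀ Θ : Fin p → ℝ) (x : Fin d → ℝ) (j : Fin p) :
    pder j (fun Θ => linF f Θ₀ Θ x) Θ = pder j (fun Θ' => modelF f Θ' x) Θ₀ := by
  rw [pder, (hasFDerivAt_linF f Θ₀ Θ x).fderiv]
  simp [Pi.single_apply]

/-- Lazy training: the loss of a local model trained by gradient flow stays within
`4√2·s⁴·c³·L(Θ(0))^{3/2}·t²/√m` of the loss of its trained linearization. -/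
theorem lazy_training_loss_bound
    {m p d n : ℕ} (hm : 1 ≤ m) (hp : 1 ≤ p) (hd : 1 ≤ d) {s c : ℝ} (hs : 1 ≤ s) (hc : 0 < c)
    (f : Fin m → (Fin p → ℝ) → (Fin d → ℝ) → ℝ) (N : Fin m → Finset (Fin p))
    (hloc : IsLocalModel f N s c)
    (X : Fin n → Fin d → ℝ) (Y : Fin n → ℝ)
    (Θ Θbar : ℝ → Fin p → ℝ)
    (hflow : ∀ t : ℝ, 0 ≤ t → ∀ j : Fin p,
      HasDerivAt (fun u => Θ u j) (-(pder j (lossL f X Y) (Θ t))) t)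
    (hflowbar : ∀ t : ℝ, 0 ≤ t → ∀ j : Fin p,
      HasDerivAt (fun u => Θbar u j) (-(pder j (linLoss f (Θ 0) X Y) (Θbar t))) t)
    (hinit : Θbar 0 = Θ 0) :
    ∀ t : ℝ, 0 ≤ t →
      |lossL f X Y (Θ t) - linLoss f (Θ 0) X Y (Θbar t)| ≤
        4 * Real.sqrt 2 * s ^ 4 * c ^ 3 * lossL f X Y (Θ 0) ^ ((3 : ℝ) / 2) * t ^ 2 /
          Real.sqrt m := by
  intro t ht
  have hφ : ∀ i, Differentiable ℝ fun Θ => modelF f Θ (X i) := fun i =>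
    (hloc.contDiff_modelF (X i)).differentiable (by norm_num)
  have hlin : ∀ i, Differentiable ℝ fun Θ' => linF f (Θ 0) Θ' (X i) := fun i Θ' =>
    (hasFDerivAt_linF f (Θ 0) Θ' (X i)).differentiableAt
  have hm' : (0 : ℝ) < √m := Real.sqrt_pos.2 (by exact_mod_cast hm)
  have key := abs_sub_le_of_residual_flow (E := EuclideanSpace ℝ (Fin p)) (n := n)
    (g := fun i t => WithLp.toLp 2 fun j => pder j (fun Θ => modelF f Θ (X i)) (Θ t))
    (g' := fun i t => WithLp.toLp 2 fun j => ∑ l, -(pder l (lossL f X Y) (Θ t)) *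
      pder l (pder j fun Θ => modelF f Θ (X i)) (Θ t))
    (r := fun i t => modelF f (Θ t) (X i) - Y i)
    (ρ := fun i t => linF f (Θ 0) (Θbar t) (X i) - Y i)
    (v := fun t => WithLp.toLp 2 fun j => -(pder j (lossL f X Y) (Θ t)))
    (w := fun t => WithLp.toLp 2 fun j => -(pder j (linLoss f (Θ 0) X Y) (Θbar t)))
    (G := s * c) (B := s ^ 2 * c / √m) (by positivity) (by positivity)
    (fun t => by
      ext j
      have e : pder j (lossL f X Y) (Θ t) = _ := pder_half_mean_sq hφ Y j (Θ t)
      simpa using e)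
    (fun t => by
      ext j
      have e : pder j (linLoss f (Θ 0) X Y) (Θbar t) = _ := pder_half_mean_sq hlin Y j (Θbar t)
      simpa [pder_linF] using e)
    (fun t ht i => by
      simpa [PiLp.inner_apply] using
        (hasDerivAt_comp_curve (hφ i (Θ t)) (hflow t ht)).sub_const (Y i))
    (fun t ht i => by
      simpa [PiLp.inner_apply, pder_linF] using
        (hasDerivAt_comp_curve (hlin i (Θbar t)) (hflowbar t ht)).sub_const (Y i))
    (fun i => by simp [linF, hinit])
    (fun t i => by
      rw [EuclideanSpace.norm_eq]
      refine Real.sqrt_le_iff.2 ⟨by positivity, ?_⟩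
      simpa using hloc.sum_sq_pder_le hm hs (X i) (Θ t))
    (fun t ht i => by
      have e : HasDerivAt (fun u j => pder j (fun Θ => modelF f Θ (X i)) (Θ u))
          (fun j => ∑ l, -(pder l (lossL f X Y) (Θ t)) *
            pder l (pder j fun Θ => modelF f Θ (X i)) (Θ t)) t :=
        hasDerivAt_pi.2 fun j => hasDerivAt_comp_curve
          (differentiable_pder (hloc.contDiff_modelF (X i)) j (Θ t)) (hflow t ht)
      exact (PiLp.hasFDerivAt_toLp (𝕜 := ℝ) 2 _).comp_hasDerivAt t e)
    (fun t ht i => by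
      rw [EuclideanSpace.norm_eq, EuclideanSpace.norm_eq]
      refine Real.sqrt_le_iff.2 ⟨by positivity, ?_⟩
      rw [mul_pow, Real.sq_sqrt (Finset.sum_nonneg fun _ _ => sq_nonneg _)]
      simpa only [Real.norm_eq_abs, sq_abs] using
        hloc.sum_sq_pder_pder_le hm hs (X i) (Θ t) fun l => -(pder l (lossL f X Y) (Θ t)))
    ht
  have hL : ∀ Θ, (n : ℝ)⁻¹ * ∑ i, (modelF f Θ (X i) - Y i) ^ 2 = 2 * lossL f X Y Θ := by
    intro Θ
    rw [lossL, ← Finset.mul_sum]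
    ring
  have hL' : (n : ℝ)⁻¹ * ∑ i, (linF f (Θ 0) (Θbar t) (X i) - Y i) ^ 2 =
      2 * linLoss f (Θ 0) X Y (Θbar t) := by
    rw [linLoss, ← Finset.mul_sum]
    ring
  have hL0 : 0 ≤ lossL f X Y (Θ 0) :=
    mul_nonneg (by positivity) (Finset.sum_nonneg fun i _ => by positivity)
  have hpow : lossL f X Y (Θ 0) ^ ((3 : ℝ) / 2) = lossL f X Y (Θ 0) * √(lossL f X Y (Θ 0)) := by
    rw [Real.sqrt_eq_rpow, show (3 : ℝ) / 2 = 1 + 1 / 2 by norm_num,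
      Real.rpow_add_of_nonneg hL0 (by norm_num) (by norm_num), Real.rpow_one]
  rw [hL, hL', hL, ← mul_sub, abs_mul, abs_two, Real.sqrt_mul (by norm_num)] at key
  rw [hpow]
  set L := lossL f X Y (Θ 0)
  have hnn : 0 ≤ √2 * s ^ 4 * c ^ 3 * (L * √L) * t ^ 2 / √m := by positivity
  calc _ ≤ (2 * (s ^ 2 * c / √m * (s * c) ^ 2) * (2 * L) * (√2 * √L) * t ^ 2) / 2 := by linarith
    _ = 2 * (√2 * s ^ 4 * c ^ 3 * (L * √L) * t ^ 2 / √m) := by ring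
    _ ≤ 4 * (√2 * s ^ 4 * c ^ 3 * (L * √L) * t ^ 2 / √m) := by linarith
    _ = _ := by ring
end

section
/- For all a, b, c, α, β, γ, φ ∈ ℝ, let V be the 8×8 complex matrix V = (I ⊗ R_X(φ) ⊗ I) · (CZ ⊗ I) · (I ⊗ CZ) · (R_X(α) ⊗ R_X(β) ⊗ R_X(γ)) · (R_Y(a) ⊗ R_Y(b) ⊗ R_Y(c)), and let Z₂ = I ⊗ Z ⊗ I. Then ⟨e₀₀₀, V† Z₂ V e₀₀₀⟩ = cos(b)cos(φ)cos(β) − cos(a)cos(b)cos(c)cos(α)cos(γ)sin(β)sin(φ), where e₀₀₀ = e_0 ⊗ e_0 ⊗ e_0 and V† is the conjugate transpose of V. -/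
open Matrix Complex

/-- The Pauli-X rotation `R_X(θ) = exp(−i(θ/2)X)`. -/
noncomputable def RX (θ : ℝ) : Matrix (Fin 2) (Fin 2) ℂ :=
  !![(Real.cos (θ / 2) : ℂ), -Complex.I * Real.sin (θ / 2);
     -Complex.I * Real.sin (θ / 2), (Real.cos (θ / 2) : ℂ)]

/-- The Pauli-Y rotation `R_Y(x) = exp(−i(x/2)Y)`. -/
noncomputable def RY (x : ℝ) : Matrix (Fin 2) (Fin 2) ℂ :=
  !![(Real.cos (x / 2) : ℂ), -(Real.sin (x / 2) : ℂ);
     (Real.sin (x / 2) : ℂ), (Real.cos (x / 2) : ℂ)]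

/-- The standard basis vector `e_b` of `ℂ²`. -/
noncomputable def e (b : Fin 2) : Fin 2 → ℂ := Pi.single b 1

/-- Triple Kronecker product `A ⊗ B ⊗ C` of `2×2` matrices, acting on
`ℂ² ⊗ ℂ² ⊗ ℂ²` indexed by `Fin 2 × Fin 2 × Fin 2`. -/
def kron3 (A B C : Matrix (Fin 2) (Fin 2) ℂ) :
    Matrix (Fin 2 × Fin 2 × Fin 2) (Fin 2 × Fin 2 × Fin 2) ℂ :=
  fun i j => A i.1 j.1 * B i.2.1 j.2.1 * C i.2.2 j.2.2

/-- The Pauli-Z matrix `diag(1,−1)`. -/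
def pauliZ : Matrix (Fin 2) (Fin 2) ℂ := !![1, 0; 0, -1]

/-- The controlled-Z matrix `diag(1,1,1,−1)` on two qubits. -/
def CZ : Matrix (Fin 2 × Fin 2) (Fin 2 × Fin 2) ℂ :=
  fun i j => if i = j then (if i = (1, 1) then -1 else 1) else 0

/-- `CZ ⊗ I`: controlled-Z on qubits 1,2 of three qubits. -/
def CZ12 : Matrix (Fin 2 × Fin 2 × Fin 2) (Fin 2 × Fin 2 × Fin 2) ℂ :=
  fun i j => CZ (i.1, i.2.1) (j.1, j.2.1) * (if i.2.2 = j.2.2 then 1 else 0)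

/-- `I ⊗ CZ`: controlled-Z on qubits 2,3 of three qubits. -/
def CZ23 : Matrix (Fin 2 × Fin 2 × Fin 2) (Fin 2 × Fin 2 × Fin 2) ℂ :=
  fun i j => (if i.1 = j.1 then 1 else 0) * CZ (i.2.1, i.2.2) (j.2.1, j.2.2)

/-- The basis vector `e₀ ⊗ e₀ ⊗ e₀` of `ℂ⁸`. -/
def e000 : Fin 2 × Fin 2 × Fin 2 → ℂ := fun i => if i = (0, 0, 0) then 1 else 0

/-- The Pauli-Y matrix. -/
def pauliY : Matrix (Fin 2) (Fin 2) ℂ := !![0, -Complex.I; Complex.I, 0]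

lemma kron3_mul (A B C A' B' C' : Matrix (Fin 2) (Fin 2) ℂ) :
    kron3 A B C * kron3 A' B' C' = kron3 (A * A') (B * B') (C * C') := by
  ext i j
  simp only [kron3, Matrix.mul_apply, Fintype.sum_prod_type, Fin.sum_univ_two]
  ring

lemma kron3_conjTranspose (A B C : Matrix (Fin 2) (Fin 2) ℂ) :
    (kron3 A B C)ᴴ = kron3 Aᴴ Bᴴ Cᴴ := by
  ext i j
  simp [kron3, Matrix.conjTranspose_apply]

lemma kron3_add_smul_middle (A B B' C : Matrix (Fin 2) (Fin 2) ℂ) (s t : ℂ) :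
    kron3 A (s • B + t • B') C = s • kron3 A B C + t • kron3 A B' C := by
  ext i j
  simp only [kron3, Matrix.add_apply, Matrix.smul_apply, smul_eq_mul]
  ring

/-- The expectation of a matrix in the state `e000` is its top-left entry. -/
lemma expectation_e000
    (M : Matrix (Fin 2 × Fin 2 × Fin 2) (Fin 2 × Fin 2 × Fin 2) ℂ) :
    ∑ i, (starRingEnd ℂ) (e000 i) * M.mulVec e000 i = M (0, 0, 0) (0, 0, 0) := by
  simp [e000, Matrix.mulVec, dotProduct]

/-- The product of the two controlled-Z gates as a diagonal matrix. -/
lemma CZ12_mul_CZ23 : CZ12 * CZ23 = Matrix.diagonal fun i : Fin 2 × Fin 2 × Fin 2 =>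
    (if (i.1, i.2.1) = (1, 1) then -1 else 1) * (if i.2 = (1, 1) then -1 else 1 : ℂ) := by
  have h12 : CZ12 = Matrix.diagonal fun i : Fin 2 × Fin 2 × Fin 2 =>
      if (i.1, i.2.1) = (1, 1) then -1 else (1 : ℂ) := by
    ext ⟨i, j, k⟩ ⟨i', j', k'⟩
    simp only [CZ12, CZ, Matrix.diagonal_apply, Prod.mk.injEq]
    grind
  have h23 : CZ23 = Matrix.diagonal fun i : Fin 2 × Fin 2 × Fin 2 =>
      if i.2 = (1, 1) then -1 else (1 : ℂ) := by
    ext ⟨i, j, k⟩ ⟨i', j', k'⟩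
    simp only [CZ23, CZ, Matrix.diagonal_apply, Prod.mk.injEq]
    grind
  rw [h12, h23, Matrix.diagonal_mul_diagonal]

lemma CZ_conj_pauliZ :
    (CZ12 * CZ23)ᴴ * kron3 1 pauliZ 1 * (CZ12 * CZ23) = kron3 1 pauliZ 1 := by
  rw [CZ12_mul_CZ23, Matrix.diagonal_conjTranspose]
  ext ⟨i, j, k⟩ ⟨i', j', k'⟩
  rw [Matrix.mul_diagonal, Matrix.diagonal_mul]
  fin_cases i <;> fin_cases j <;> fin_cases k <;> fin_cases i' <;> fin_cases j' <;>
    fin_cases k' <;> simp [kron3, pauliZ]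

lemma CZ_conj_pauliY :
    (CZ12 * CZ23)ᴴ * kron3 1 pauliY 1 * (CZ12 * CZ23) = kron3 pauliZ pauliY pauliZ := by
  rw [CZ12_mul_CZ23, Matrix.diagonal_conjTranspose]
  ext ⟨i, j, k⟩ ⟨i', j', k'⟩
  rw [Matrix.mul_diagonal, Matrix.diagonal_mul]
  fin_cases i <;> fin_cases j <;> fin_cases k <;> fin_cases i' <;> fin_cases j' <;>
    fin_cases k' <;> simp [kron3, pauliZ, pauliY]

lemma cos_eq_half (x : ℝ) :
    (Real.cos x : ℂ) = (Real.cos (x / 2) : ℂ) ^ 2 - (Real.sin (x / 2) : ℂ) ^ 2 := by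
  have h := Real.cos_two_mul' (x / 2)
  rw [mul_div_cancel₀ x two_ne_zero] at h
  exact_mod_cast h

lemma sin_eq_half (x : ℝ) :
    (Real.sin x : ℂ) = 2 * (Real.sin (x / 2) : ℂ) * (Real.cos (x / 2) : ℂ) := by
  have h := Real.sin_two_mul (x / 2)
  rw [mul_div_cancel₀ x two_ne_zero] at h
  exact_mod_cast h

lemma cos_half_sq_add_sin_half_sq (x : ℝ) :
    (Real.cos (x / 2) : ℂ) ^ 2 + (Real.sin (x / 2) : ℂ) ^ 2 = 1 := by
  exact_mod_cast Real.cos_sq_add_sin_sq (x / 2)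

lemma RX_conjTranspose (θ : ℝ) : (RX θ)ᴴ =
    !![(Real.cos (θ / 2) : ℂ), Complex.I * Real.sin (θ / 2);
       Complex.I * Real.sin (θ / 2), (Real.cos (θ / 2) : ℂ)] := by
  ext i j
  fin_cases i <;> fin_cases j <;>
    simp [RX, Matrix.conjTranspose_apply, -Complex.ofReal_cos, -Complex.ofReal_sin]

lemma RY_conjTranspose (x : ℝ) : (RY x)ᴴ =
    !![(Real.cos (x / 2) : ℂ), (Real.sin (x / 2) : ℂ);
       -(Real.sin (x / 2) : ℂ), (Real.cos (x / 2) : ℂ)] := by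
  ext i j
  fin_cases i <;> fin_cases j <;>
    simp [RY, Matrix.conjTranspose_apply, -Complex.ofReal_cos, -Complex.ofReal_sin]

lemma RX_unitary (θ : ℝ) : (RX θ)ᴴ * RX θ = 1 := by
  rw [RX_conjTranspose, RX, Matrix.mul_fin_two, Matrix.one_fin_two]
  have h := cos_half_sq_add_sin_half_sq θ
  congr! 3 <;> grind [Complex.I_sq]

lemma RY_unitary (x : ℝ) : (RY x)ᴴ * RY x = 1 := by
  rw [RY_conjTranspose, RY, Matrix.mul_fin_two, Matrix.one_fin_two]
  have h := cos_half_sq_add_sin_half_sq x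
  congr! 3 <;> grind

lemma RX_conj_pauliZ (θ : ℝ) : (RX θ)ᴴ * pauliZ * RX θ =
    (Real.cos θ : ℂ) • pauliZ + (Real.sin θ : ℂ) • pauliY := by
  rw [RX_conjTranspose, RX, pauliZ, pauliY, cos_eq_half θ, sin_eq_half θ]
  ext i j
  fin_cases i <;> fin_cases j <;>
    simp [-Complex.ofReal_cos, -Complex.ofReal_sin] <;> grind [Complex.I_sq]

lemma RX_conj_pauliY (θ : ℝ) : (RX θ)ᴴ * pauliY * RX θ =
    (Real.cos θ : ℂ) • pauliY + (-Real.sin θ : ℂ) • pauliZ := by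
  rw [RX_conjTranspose, RX, pauliZ, pauliY, cos_eq_half θ, sin_eq_half θ]
  ext i j
  fin_cases i <;> fin_cases j <;>
    simp [-Complex.ofReal_cos, -Complex.ofReal_sin] <;> grind [Complex.I_sq]

lemma RY_conj_pauliZ_apply (x : ℝ) : ((RY x)ᴴ * pauliZ * RY x) 0 0 = Real.cos x := by
  rw [RY_conjTranspose, RY, pauliZ, cos_eq_half x]
  simp [-Complex.ofReal_cos, -Complex.ofReal_sin]
  ring

lemma RY_conj_pauliY_apply (x : ℝ) : ((RY x)ᴴ * pauliY * RY x) 0 0 = 0 := by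
  rw [RY_conjTranspose, RY, pauliY]
  simp [-Complex.ofReal_cos, -Complex.ofReal_sin]
  ring

/-- Conjugating a Pauli matrix by `R_X(θ) R_Y(x)`: the top-left entry for `Z`. -/
lemma RX_RY_conj_pauliZ_apply (θ x : ℝ) :
    ((RY x)ᴴ * ((RX θ)ᴴ * pauliZ * RX θ) * RY x) 0 0 = Real.cos θ * Real.cos x := by
  rw [RX_conj_pauliZ, mul_add, add_mul, Matrix.add_apply]
  simp only [Matrix.mul_smul, Matrix.smul_mul, Matrix.smul_apply, smul_eq_mul,
    RY_conj_pauliZ_apply, RY_conj_pauliY_apply, mul_zero, add_zero]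

/-- Conjugating a Pauli matrix by `R_X(θ) R_Y(x)`: the top-left entry for `Y`. -/
lemma RX_RY_conj_pauliY_apply (θ x : ℝ) :
    ((RY x)ᴴ * ((RX θ)ᴴ * pauliY * RX θ) * RY x) 0 0 = -Real.sin θ * Real.cos x := by
  rw [RX_conj_pauliY, mul_add, add_mul, Matrix.add_apply]
  simp only [Matrix.mul_smul, Matrix.smul_mul, Matrix.smul_apply, smul_eq_mul,
    RY_conj_pauliZ_apply, RY_conj_pauliY_apply, mul_zero, zero_add]

/-- The light-cone computation of `f_k` for the two-layer circuit:
`⟨e₀₀₀, V† (I⊗Z⊗I) V e₀₀₀⟩ = cos b cos φ cos β − cos a cos b cos c cos α cos γ sin β sin φ`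
for `V = (I⊗R_X(φ)⊗I)(CZ⊗I)(I⊗CZ)(R_X(α)⊗R_X(β)⊗R_X(γ))(R_Y(a)⊗R_Y(b)⊗R_Y(c))`. -/
theorem two_layer_lightcone_model_function (a b c α β γ φ : ℝ) :
    (∑ i : Fin 2 × Fin 2 × Fin 2,
        (starRingEnd ℂ) (e000 i) *
          ((kron3 1 (RX φ) 1 * CZ12 * CZ23 * kron3 (RX α) (RX β) (RX γ) *
              kron3 (RY a) (RY b) (RY c))ᴴ *
            kron3 1 pauliZ 1 *
            (kron3 1 (RX φ) 1 * CZ12 * CZ23 * kron3 (RX α) (RX β) (RX γ) *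
              kron3 (RY a) (RY b) (RY c))).mulVec e000 i) =
      ((Real.cos b * Real.cos φ * Real.cos β -
          Real.cos a * Real.cos b * Real.cos c * Real.cos α * Real.cos γ *
            Real.sin β * Real.sin φ : ℝ) : ℂ) := by
  have regroup : ∀ P C D Q R M : Matrix (Fin 2 × Fin 2 × Fin 2) (Fin 2 × Fin 2 × Fin 2) ℂ,
      (P * C * D * Q * R)ᴴ * M * (P * C * D * Q * R) =
        Rᴴ * (Qᴴ * ((C * D)ᴴ * (Pᴴ * M * P) * (C * D)) * Q) * R := by
    intro P C D Q R M
    simp only [Matrix.conjTranspose_mul, Matrix.mul_assoc]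
  rw [expectation_e000, regroup]
  simp only [kron3_conjTranspose, kron3_mul, Matrix.conjTranspose_one, mul_one]
  rw [RX_conj_pauliZ, kron3_add_smul_middle, mul_add, add_mul]
  simp only [Matrix.mul_smul, Matrix.smul_mul, CZ_conj_pauliZ, CZ_conj_pauliY, mul_add, add_mul,
    kron3_mul, mul_one, RX_unitary, RY_unitary]
  simp only [Matrix.add_apply, Matrix.smul_apply, smul_eq_mul, kron3,
    RX_RY_conj_pauliZ_apply, RX_RY_conj_pauliY_apply, Matrix.one_apply_eq]
  push_cast
  ring
end

section
/- Define g : ℝ⁴ × ℝ³ → ℝ by g(α,β,γ,φ; a,b,c) = cos(b)cos(φ)cos(β) − cos(a)cos(b)cos(c)cos(α)cos(γ)sin(β)sin(φ). Let (α,β,γ,φ) be uniformly distributed on [−2π,2π]⁴. Then for all a,b,c,a',b',c' ∈ ℝ: E[ ∂_α g(α,β,γ,φ; a,b,c) · ∂_α g(α,β,γ,φ; a',b',c') ] = (1/16)·cos(a)cos(b)cos(c)·cos(a')cos(b')cos(c'), and the same identity holds with ∂_α replaced by ∂_γ. -/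
open Real MeasureTheory

/-- The explicit two-layer light-cone model function
`g(α,β,γ,φ;a,b,c) = cos b cos φ cos β − cos a cos b cos c cos α cos γ sin β sin φ`. -/
noncomputable def g (α β γ φ a b c : ℝ) : ℝ :=
  Real.cos b * Real.cos φ * Real.cos β -
    Real.cos a * Real.cos b * Real.cos c * Real.cos α * Real.cos γ *
      Real.sin β * Real.sin φ

/-- The box `[−2π, 2π]⁴`. -/
noncomputable def box4 : Set (Fin 4 → ℝ) :=
  Set.univ.pi fun _ => Set.Icc (-(2 * π)) (2 * π)

theorem setIntegral_pi_prod {ι : Type*} [Fintype ι] (s : ι → Set ℝ) (f : ι → ℝ → ℝ) :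
    ∫ z in Set.univ.pi s, ∏ i, f i (z i) = ∏ i, ∫ x in s i, f i x := by
  rw [volume_pi, Measure.restrict_pi_pi]
  exact integral_fintype_prod_eq_prod f

theorem setIntegral_sin_sq_Icc :
    ∫ x in Set.Icc (-(2 * π)) (2 * π), Real.sin x ^ 2 = 2 * π := by
  rw [integral_Icc_eq_integral_Ioc,
    ← intervalIntegral.integral_of_le (by linarith [Real.pi_pos]), integral_sin_sq]
  simp

theorem setIntegral_cos_sq_Icc :
    ∫ x in Set.Icc (-(2 * π)) (2 * π), Real.cos x ^ 2 = 2 * π := by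
  rw [integral_Icc_eq_integral_Ioc,
    ← intervalIntegral.integral_of_le (by linarith [Real.pi_pos]), integral_cos_sq]
  simp

theorem volume_box4_toReal : (volume box4).toReal = (4 * π) ^ 4 := by
  have h : (0 : ℝ) ≤ 2 * π + 2 * π := by positivity
  rw [box4, volume_pi, Measure.pi_pi]
  simp only [Real.volume_Icc, sub_neg_eq_add, Finset.prod_const, Finset.card_univ,
    Fintype.card_fin, ENNReal.toReal_pow, ENNReal.toReal_ofReal h]
  ring

theorem deriv_g_alpha (α β γ φ a b c : ℝ) :
    deriv (fun α => g α β γ φ a b c) α =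
      Real.cos a * Real.cos b * Real.cos c * Real.sin α * Real.cos γ *
        Real.sin β * Real.sin φ := by
  have h := ((((((Real.hasDerivAt_cos α).const_mul
    (Real.cos a * Real.cos b * Real.cos c)).mul_const (Real.cos γ)).mul_const
    (Real.sin β)).mul_const (Real.sin φ)).const_sub (Real.cos b * Real.cos φ * Real.cos β))
  exact h.deriv.trans (by ring)

theorem deriv_g_gamma (α β γ φ a b c : ℝ) :
    deriv (fun γ => g α β γ φ a b c) γ =
      Real.cos a * Real.cos b * Real.cos c * Real.cos α * Real.sin γ *
        Real.sin β * Real.sin φ := by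
  have h : (fun γ => g α β γ φ a b c) = fun γ => g γ β α φ a b c := by
    funext γ
    unfold g
    ring
  rw [h, deriv_g_alpha]
  ring

/-- For `(α,β,γ,φ)` uniform on `[−2π,2π]⁴`,
`E[∂_α g(·;a,b,c)·∂_α g(·;a',b',c')] = (1/16)·cos a cos b cos c·cos a' cos b' cos c'`,
and the same holds with `∂_α` replaced by `∂_γ`. -/
theorem expected_partial_products_alpha_gamma (a b c a' b' c' : ℝ) :
    ((volume box4).toReal⁻¹ *
        ∫ z in box4, deriv (fun α => g α (z 1) (z 2) (z 3) a b c) (z 0) *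
          deriv (fun α => g α (z 1) (z 2) (z 3) a' b' c') (z 0) =
      (1 / 16) * (Real.cos a * Real.cos b * Real.cos c) *
        (Real.cos a' * Real.cos b' * Real.cos c')) ∧
    ((volume box4).toReal⁻¹ *
        ∫ z in box4, deriv (fun γ => g (z 0) (z 1) γ (z 3) a b c) (z 2) *
          deriv (fun γ => g (z 0) (z 1) γ (z 3) a' b' c') (z 2) =
      (1 / 16) * (Real.cos a * Real.cos b * Real.cos c) *
        (Real.cos a' * Real.cos b' * Real.cos c')) := by
  have hπ := Real.pi_ne_zero
  constructor
  · have h := setIntegral_pi_prod (fun _ : Fin 4 => Set.Icc (-(2 * π)) (2 * π))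
      ![fun x => Real.sin x ^ 2, fun x => Real.sin x ^ 2, fun x => Real.cos x ^ 2,
        fun x => Real.sin x ^ 2]
    simp only [Fin.prod_univ_four, Matrix.cons_val, setIntegral_sin_sq_Icc,
      setIntegral_cos_sq_Icc] at h
    simp only [deriv_g_alpha]
    rw [volume_box4_toReal]
    calc _ = ((4 * π) ^ 4)⁻¹ * ∫ z in box4,
          (Real.cos a * Real.cos b * Real.cos c * (Real.cos a' * Real.cos b' * Real.cos c')) *
          (Real.sin (z 0) ^ 2 * Real.sin (z 1) ^ 2 * Real.cos (z 2) ^ 2 *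
            Real.sin (z 3) ^ 2) := by
          congr 2
          ext z
          ring
      _ = _ := by
          rw [integral_const_mul, box4, h]
          field_simp
          ring
  · have h := setIntegral_pi_prod (fun _ : Fin 4 => Set.Icc (-(2 * π)) (2 * π))
      ![fun x => Real.cos x ^ 2, fun x => Real.sin x ^ 2, fun x => Real.sin x ^ 2,
        fun x => Real.sin x ^ 2]
    simp only [Fin.prod_univ_four, Matrix.cons_val, setIntegral_sin_sq_Icc,
      setIntegral_cos_sq_Icc] at h
    simp only [deriv_g_gamma]
    rw [volume_box4_toReal]
    calc _ = ((4 * π) ^ 4)⁻¹ * ∫ z in box4,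
          (Real.cos a * Real.cos b * Real.cos c * (Real.cos a' * Real.cos b' * Real.cos c')) *
          (Real.cos (z 0) ^ 2 * Real.sin (z 1) ^ 2 * Real.sin (z 2) ^ 2 *
            Real.sin (z 3) ^ 2) := by
          congr 2
          ext z
          ring
      _ = _ := by
          rw [integral_const_mul, box4, h]
          field_simp
          ring
end

section
/- Fix an integer m ≥ 3 and read all qubit indices modulo m (in {1,…,m}). For Θ = (θ_1,…,θ_{2m}) ∈ ℝ^{2m} and x̂ ∈ ℝ^m, define f_k(Θ,x̂) = cos(x̂_k)cos(θ_{m+k})cos(θ_k) − cos(x̂_{k−1})cos(x̂_k)cos(x̂_{k+1})cos(θ_{k−1})cos(θ_{k+1})sin(θ_k)sin(θ_{m+k}) for k = 1,…,m, set f(Θ,x̂) = m^{-1/2} Σ_{k=1}^m f_k(Θ,x̂), and define the tangent kernel K_Θ(x̂,x̂') = Σ_{j=1}^{2m} ∂_{θ_j} f(Θ,x̂)·∂_{θ_j} f(Θ,x̂'). If Θ is uniformly distributed on [−2π,2π]^{2m}, then for all x̂, x̂' ∈ ℝ^m: E[K_Θ(x̂,x̂')] = (1/(4m)) Σ_{k=1}^m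 [ 2·cos(x̂_k)cos(x̂'_k) + cos(x̂_{k−1})cos(x̂_k)cos(x̂_{k+1})·cos(x̂'_{k−1})cos(x̂'_k)cos(x̂'_{k+1}) ]. -/
open Real MeasureTheory

/-- Embedding of the first-layer parameter index `k` into `{1,…,2m}`: `θ_k`. -/
def idx1 {m : ℕ} (k : Fin m) : Fin (2 * m) := ⟨k, by have := k.isLt; omega⟩

/-- Embedding of the second-layer parameter index `k` into `{1,…,2m}`: `θ_{m+k}`. -/
def idx2 {m : ℕ} (k : Fin m) : Fin (2 * m) := ⟨m + k, by have := k.isLt; omega⟩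

/-- The contribution of the `k`-th `Z` measurement of the two-layer circuit on a cycle of
`m` qubits (indices cyclic modulo `m`):
`f_k(Θ,x̂) = cos x̂_k cos θ_{m+k} cos θ_k −
  cos x̂_{k−1} cos x̂_k cos x̂_{k+1} cos θ_{k−1} cos θ_{k+1} sin θ_k sin θ_{m+k}`. -/
noncomputable def fk2 {m : ℕ} [NeZero m] (k : Fin m) (Θ : Fin (2 * m) → ℝ)
    (x : Fin m → ℝ) : ℝ :=
  Real.cos (x k) * Real.cos (Θ (idx2 k)) * Real.cos (Θ (idx1 k)) -
    Real.cos (x (k - 1)) * Real.cos (x k) * Real.cos (x (k + 1)) *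
      Real.cos (Θ (idx1 (k - 1))) * Real.cos (Θ (idx1 (k + 1))) *
      Real.sin (Θ (idx1 k)) * Real.sin (Θ (idx2 k))

/-- The model function `f(Θ,x̂) = m^{-1/2} ∑_k f_k(Θ,x̂)`. -/
noncomputable def model2 {m : ℕ} [NeZero m] (Θ : Fin (2 * m) → ℝ) (x : Fin m → ℝ) : ℝ :=
  (Real.sqrt m)⁻¹ * ∑ k : Fin m, fk2 k Θ x

/-- The tangent kernel `K_Θ(x̂,x̂') = ∑_{j=1}^{2m} ∂_{θ_j} f(Θ,x̂)·∂_{θ_j} f(Θ,x̂')`. -/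
noncomputable def kernel2 {m : ℕ} [NeZero m] (Θ : Fin (2 * m) → ℝ)
    (x x' : Fin m → ℝ) : ℝ :=
  ∑ j : Fin (2 * m), pder j (fun Θ' => model2 Θ' x) Θ * pder j (fun Θ' => model2 Θ' x') Θ

/-- The box `[−2π, 2π]^{2m}`. -/
noncomputable def box2m (m : ℕ) : Set (Fin (2 * m) → ℝ) :=
  Set.univ.pi fun _ => Set.Icc (-(2 * π)) (2 * π)

/-- The trigonometric functions `1`, `cos`, `sin`, indexed by `0`, `1`, `2`. -/
noncomputable def trig (a : Fin 3) (t : ℝ) : ℝ := ![1, Real.cos t, Real.sin t] a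

/-- The derivatives of `1`, `cos`, `sin`, indexed by `0`, `1`, `2`. -/
noncomputable def trigDeriv (a : Fin 3) (t : ℝ) : ℝ := ![0, -Real.sin t, Real.cos t] a

/-- The trigonometric monomial `∏ i, trig (a i) (Θ i)`. -/
noncomputable def trigMonomial {p : ℕ} (a : Fin p → Fin 3) (Θ : Fin p → ℝ) : ℝ :=
  ∏ i, trig (a i) (Θ i)

/-- The set of coordinates on which a trigonometric monomial depends. -/
def labelSupport {p : ℕ} (a : Fin p → Fin 3) : Finset (Fin p) :=
  Finset.univ.filter fun i => a i ≠ 0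

theorem hasDerivAt_trig (a : Fin 3) (t : ℝ) : HasDerivAt (trig a) (trigDeriv a t) t := by
  fin_cases a
  · exact hasDerivAt_const t (1 : ℝ)
  · exact Real.hasDerivAt_cos t
  · exact Real.hasDerivAt_sin t

theorem continuous_trig (a : Fin 3) : Continuous (trig a) :=
  continuous_iff_continuousAt.2 fun t => (hasDerivAt_trig a t).continuousAt

theorem continuous_trigDeriv (a : Fin 3) : Continuous (trigDeriv a) := by
  fin_cases a
  · exact continuous_const
  · exact Real.continuous_sin.neg
  · exact Real.continuous_cos

theorem setIntegral_trig_mul_trig (a b : Fin 3) :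
    ∫ t in Set.Icc (-(2 * π)) (2 * π), trig a t * trig b t =
      4 * π * if a = b then (if a = 0 then 1 else 1 / 2) else 0 := by
  rw [integral_Icc_eq_integral_Ioc, ← intervalIntegral.integral_of_le (by linarith [pi_pos])]
  have hcs : ∫ t in (-(2 * π))..(2 * π), Real.cos t * Real.sin t = 0 := by
    simp_rw [mul_comm (Real.cos _)]
    simp [integral_sin_mul_cos₁]
  fin_cases a <;> fin_cases b <;>
    simp [trig, ← sq, integral_sin_sq, integral_cos_sq, integral_sin_mul_cos₁, hcs] <;> ring

theorem setIntegral_trigDeriv_mul_trigDeriv (a b : Fin 3) :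
    ∫ t in Set.Icc (-(2 * π)) (2 * π), trigDeriv a t * trigDeriv b t =
      4 * π * if a = b then (if a = 0 then 0 else 1 / 2) else 0 := by
  rw [integral_Icc_eq_integral_Ioc, ← intervalIntegral.integral_of_le (by linarith [pi_pos])]
  have hcs : ∫ t in (-(2 * π))..(2 * π), Real.cos t * Real.sin t = 0 := by
    simp_rw [mul_comm (Real.cos _)]
    simp [integral_sin_mul_cos₁]
  fin_cases a <;> fin_cases b <;>
    simp [trigDeriv, ← sq, integral_sin_sq, integral_cos_sq, integral_sin_mul_cos₁, hcs] <;> ring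

theorem hasFDerivAt_trigMonomial {p : ℕ} (a : Fin p → Fin 3) (Θ : Fin p → ℝ) :
    HasFDerivAt (trigMonomial a)
      (∑ i, (∏ l ∈ Finset.univ.erase i, trig (a l) (Θ l)) •
        (trigDeriv (a i) (Θ i) • ContinuousLinearMap.proj (R := ℝ) (φ := fun _ : Fin p => ℝ) i))
      Θ := by
  refine HasFDerivAt.finsetProd fun i _ => ?_
  have h : HasFDerivAt (fun Θ' : Fin p → ℝ => Θ' i) (ContinuousLinearMap.proj (R := ℝ) i) Θ :=
    hasFDerivAt_apply i Θ
  exact (hasDerivAt_trig (a i) (Θ i)).comp_hasFDerivAt Θ h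

theorem pder_trigMonomial {p : ℕ} (j : Fin p) (a : Fin p → Fin 3) (Θ : Fin p → ℝ) :
    pder j (trigMonomial a) Θ =
      ∏ i, (if i = j then trigDeriv else trig) (a i) (Θ i) := by
  rw [pder, (hasFDerivAt_trigMonomial a Θ).fderiv,
    ← Finset.mul_prod_erase _ _ (Finset.mem_univ j)]
  have h : ∏ i ∈ Finset.univ.erase j, (if i = j then trigDeriv else trig) (a i) (Θ i) =
      ∏ i ∈ Finset.univ.erase j, trig (a i) (Θ i) :=
    Finset.prod_congr rfl fun i hi => by rw [if_neg (Finset.ne_of_mem_erase hi)]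
  simp [h, Pi.single_apply, mul_comm]

theorem pder_sum_trigMonomial {p : ℕ} {ι : Type*} [Fintype ι] (j : Fin p) (c : ι → ℝ)
    (a : ι → Fin p → Fin 3) (Θ : Fin p → ℝ) :
    pder j (fun Θ' => ∑ s, c s * trigMonomial (a s) Θ') Θ =
      ∑ s, c s * pder j (trigMonomial (a s)) Θ := by
  have h : HasFDerivAt (fun Θ' => ∑ s, c s * trigMonomial (a s) Θ')
      (∑ s, c s • fderiv ℝ (trigMonomial (a s)) Θ) Θ :=
    HasFDerivAt.fun_sum fun s _ =>
      ((hasFDerivAt_trigMonomial (a s) Θ).differentiableAt.hasFDerivAt).const_mul (c s)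
  simp [pder, h.fderiv]

theorem continuous_pder_trigMonomial {p : ℕ} (j : Fin p) (a : Fin p → Fin 3) :
    Continuous (pder j (trigMonomial a)) := by
  rw [funext (pder_trigMonomial j a)]
  refine continuous_finsetProd _ fun i _ => ?_
  split_ifs
  · exact (continuous_trigDeriv _).comp (continuous_apply i)
  · exact (continuous_trig _).comp (continuous_apply i)

theorem setIntegral_pder_mul_pder {p : ℕ} (j : Fin p) (a b : Fin p → Fin 3) :
    ∫ Θ in Set.univ.pi fun _ => Set.Icc (-(2 * π)) (2 * π),
        pder j (trigMonomial a) Θ * pder j (trigMonomial b) Θ =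
      (4 * π) ^ p *
        if a = b then (if a j = 0 then 0 else (1 / 2) ^ (labelSupport a).card) else 0 := by
  simp_rw [pder_trigMonomial, ← Finset.prod_mul_distrib]
  rw [volume_pi, Measure.restrict_pi_pi,
    integral_fintype_prod_eq_prod (𝕜 := ℝ) (fun i t =>
      (if i = j then trigDeriv else trig) (a i) t * (if i = j then trigDeriv else trig) (b i) t)]
  have h : ∀ i, ∫ t in Set.Icc (-(2 * π)) (2 * π),
      (if i = j then trigDeriv else trig) (a i) t * (if i = j then trigDeriv else trig) (b i) t =
      4 * π * if a i = b i then
        (if a i = 0 then (if i = j then 0 else 1) else 1 / 2) else 0 := by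
    intro i
    split_ifs <;> simp_all [setIntegral_trig_mul_trig, setIntegral_trigDeriv_mul_trigDeriv]
  simp_rw [h, Finset.prod_mul_distrib]
  congr 1
  · simp [mul_pow]
  by_cases hab : a = b
  · subst hab
    simp only [if_true]
    by_cases hj : a j = 0
    · rw [if_pos hj]
      exact Finset.prod_eq_zero (Finset.mem_univ j) (by simp [hj])
    · rw [if_neg hj, labelSupport, ← Finset.prod_const, Finset.prod_filter]
      refine Finset.prod_congr rfl fun i _ => ?_
      by_cases hi : a i = 0
      · have : i ≠ j := fun hij => hj (hij ▸ hi)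
        simp [hi, this]
      · simp [hi]
  · obtain ⟨i, hi⟩ := Function.ne_iff.1 hab
    rw [if_neg hab]
    exact Finset.prod_eq_zero (Finset.mem_univ i) (by simp [hi])

theorem setIntegral_sum_pder_mul_pder {p : ℕ} {ι : Type*} [Fintype ι] (c c' : ι → ℝ)
    {a : ι → Fin p → Fin 3} (ha : Function.Injective a) :
    ∫ Θ in Set.univ.pi fun _ => Set.Icc (-(2 * π)) (2 * π),
        ∑ j : Fin p, pder j (fun Θ' => ∑ s, c s * trigMonomial (a s) Θ') Θ *
          pder j (fun Θ' => ∑ s, c' s * trigMonomial (a s) Θ') Θ =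
      (4 * π) ^ p * ∑ s, c s * c' s *
        ((labelSupport (a s)).card * (1 / 2) ^ (labelSupport (a s)).card) := by
  classical
  have hint : ∀ (j : Fin p) (s t : ι), IntegrableOn (fun Θ : Fin p → ℝ =>
      c s * pder j (trigMonomial (a s)) Θ * (c' t * pder j (trigMonomial (a t)) Θ))
      (Set.univ.pi fun _ => Set.Icc (-(2 * π)) (2 * π)) := fun j s t =>
    Continuous.continuousOn (((continuous_pder_trigMonomial j (a s)).const_mul _).mul
      ((continuous_pder_trigMonomial j (a t)).const_mul _)) |>.integrableOn_compact
        (isCompact_univ_pi fun _ => isCompact_Icc)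
  simp_rw [pder_sum_trigMonomial, Finset.sum_mul_sum]
  rw [integral_finsetSum _ fun j _ => integrable_finsetSum _ fun s _ =>
    integrable_finsetSum _ fun t _ => hint j s t]
  have hj : ∀ j : Fin p, ∫ Θ in Set.univ.pi fun _ => Set.Icc (-(2 * π)) (2 * π),
      ∑ s, ∑ t, c s * pder j (trigMonomial (a s)) Θ * (c' t * pder j (trigMonomial (a t)) Θ) =
      ∑ s, (4 * π) ^ p * (c s * c' s *
        if a s j = 0 then 0 else (1 / 2) ^ (labelSupport (a s)).card) := by
    intro j
    rw [integral_finsetSum _ fun s _ => integrable_finsetSum _ fun t _ => hint j s t]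
    refine Finset.sum_congr rfl fun s _ => ?_
    rw [integral_finsetSum _ fun t _ => hint j s t]
    simp_rw [mul_mul_mul_comm (c s), integral_const_mul, setIntegral_pder_mul_pder]
    rw [Finset.sum_eq_single s]
    · simp only [if_true]
      ring
    · intro t _ hts
      rw [if_neg fun h => hts (ha h).symm]
      simp
    · simp
  simp_rw [hj]
  rw [Finset.sum_comm, Finset.mul_sum]
  refine Finset.sum_congr rfl fun s _ => ?_
  rw [← Finset.mul_sum, ← Finset.mul_sum]
  congr 2
  rw [← nsmul_eq_mul, ← Finset.sum_const]
  conv_rhs => rw [labelSupport, Finset.sum_filter]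
  exact Finset.sum_congr rfl fun j _ => by by_cases h : a s j = 0 <;> simp [h, labelSupport]

theorem trigMonomial_zero {p : ℕ} (Θ : Fin p → ℝ) : trigMonomial 0 Θ = 1 := by
  simp [trigMonomial, trig]

theorem trigMonomial_update {p : ℕ} {a : Fin p → Fin 3} {i : Fin p} (hi : a i = 0) (l : Fin 3)
    (Θ : Fin p → ℝ) :
    trigMonomial (Function.update a i l) Θ = trig l (Θ i) * trigMonomial a Θ := by
  rw [trigMonomial, trigMonomial, ← Finset.mul_prod_erase _ _ (Finset.mem_univ i),
    ← Finset.mul_prod_erase Finset.univ (fun j => trig (a j) (Θ j)) (Finset.mem_univ i)]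
  have h : ∏ j ∈ Finset.univ.erase i, trig (Function.update a i l j) (Θ j) =
      ∏ j ∈ Finset.univ.erase i, trig (a j) (Θ j) :=
    Finset.prod_congr rfl fun j hj => by
      rw [Function.update_of_ne (Finset.ne_of_mem_erase hj)]
  rw [h, Function.update_self, hi]
  simp [trig]

theorem card_labelSupport_zero {p : ℕ} : (labelSupport (0 : Fin p → Fin 3)).card = 0 := by
  simp [labelSupport]

theorem card_labelSupport_update {p : ℕ} {a : Fin p → Fin 3} {i : Fin p} (hi : a i = 0)
    {l : Fin 3} (hl : l ≠ 0) :
    (labelSupport (Function.update a i l)).card = (labelSupport a).card + 1 := by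
  have h : labelSupport (Function.update a i l) = insert i (labelSupport a) := by
    ext j
    by_cases hj : j = i
    · subst hj
      simp [labelSupport, hl]
    · simp [labelSupport, hj]
  rw [h, Finset.card_insert_of_notMem (by simp [labelSupport, hi])]

theorem idx1_inj {m : ℕ} {k l : Fin m} : idx1 k = idx1 l ↔ k = l := by
  simp [idx1, Fin.ext_iff]

theorem idx2_inj {m : ℕ} {k l : Fin m} : idx2 k = idx2 l ↔ k = l := by
  simp [idx2, Fin.ext_iff]

theorem idx1_ne_idx2 {m : ℕ} (k l : Fin m) : idx1 k ≠ idx2 l := by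
  have := k.isLt
  simp only [idx1, idx2, ne_eq, Fin.mk.injEq]
  omega

section Cycle

variable {m : ℕ} [NeZero m]

theorem fin_sub_one_ne_self (hm : 3 ≤ m) (k : Fin m) : k - 1 ≠ k := by
  obtain ⟨n, rfl⟩ : ∃ n, m = n + 3 := ⟨m - 3, by omega⟩
  simp

theorem fin_add_one_ne_self (hm : 3 ≤ m) (k : Fin m) : k + 1 ≠ k := by
  obtain ⟨n, rfl⟩ : ∃ n, m = n + 3 := ⟨m - 3, by omega⟩
  simp

theorem fin_sub_one_ne_add_one (hm : 3 ≤ m) (k : Fin m) : k - 1 ≠ k + 1 := by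
  obtain ⟨n, rfl⟩ : ∃ n, m = n + 3 := ⟨m - 3, by omega⟩
  intro h
  have h2 : (1 + 1 : Fin (n + 3)) = 0 := by
    have := sub_eq_iff_eq_add.1 h
    rw [add_assoc] at this
    exact (left_eq_add.1 this)
  have := congrArg Fin.val h2
  rw [Fin.val_add, Fin.val_one, Fin.val_zero, Nat.mod_eq_of_lt (by omega)] at this
  omega

/-- The labels of the two trigonometric monomials in `fk2 k`. -/
def modelLabel : Fin m ⊕ Fin m → Fin (2 * m) → Fin 3
  | .inl k => Function.update (Function.update 0 (idx1 k) 1) (idx2 k) 1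
  | .inr k =>
    Function.update (Function.update (Function.update (Function.update 0
      (idx1 (k - 1)) 1) (idx1 (k + 1)) 1) (idx1 k) 2) (idx2 k) 2

/-- The coefficients of the trigonometric monomials in `model2`. -/
noncomputable def modelCoeff (x : Fin m → ℝ) : Fin m ⊕ Fin m → ℝ
  | .inl k => (Real.sqrt m)⁻¹ * Real.cos (x k)
  | .inr k =>
    -((Real.sqrt m)⁻¹ * (Real.cos (x (k - 1)) * Real.cos (x k) * Real.cos (x (k + 1))))

theorem modelLabel_injective : Function.Injective (modelLabel (m := m)) := by
  have hl : ∀ k l : Fin m, modelLabel (.inl k) (idx2 l) = if l = k then 1 else 0 := by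
    intro k l
    simp [modelLabel, Function.update_apply, idx2_inj, (idx1_ne_idx2 _ _).symm]
  have hr : ∀ k l : Fin m, modelLabel (.inr k) (idx2 l) = if l = k then 2 else 0 := by
    intro k l
    simp [modelLabel, Function.update_apply, idx2_inj, (idx1_ne_idx2 _ _).symm]
  rintro (k | k) (l | l) h <;> have h' := congrFun h (idx2 k) <;>
    simp only [hl, hr, if_true] at h' <;> split_ifs at h' with hkl <;> simp_all

theorem model2_eq_sum (hm : 3 ≤ m) (Θ : Fin (2 * m) → ℝ) (x : Fin m → ℝ) :
    model2 Θ x = ∑ s, modelCoeff x s * trigMonomial (modelLabel s) Θ := by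
  rw [model2, Fintype.sum_sum_type, ← Finset.sum_add_distrib, Finset.mul_sum]
  refine Finset.sum_congr rfl fun k _ => ?_
  have hl : trigMonomial (modelLabel (.inl k)) Θ =
      Real.cos (Θ (idx2 k)) * Real.cos (Θ (idx1 k)) := by
    rw [modelLabel, trigMonomial_update, trigMonomial_update, trigMonomial_zero]
    · simp [trig]
    all_goals simp [(idx1_ne_idx2 _ _).symm]
  have hr : trigMonomial (modelLabel (.inr k)) Θ =
      Real.sin (Θ (idx2 k)) * (Real.sin (Θ (idx1 k)) *
        (Real.cos (Θ (idx1 (k + 1))) * Real.cos (Θ (idx1 (k - 1))))) := by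
    rw [modelLabel, trigMonomial_update, trigMonomial_update, trigMonomial_update,
      trigMonomial_update, trigMonomial_zero]
    · simp [trig]
    all_goals simp [(idx1_ne_idx2 _ _).symm, idx1_inj,
      (fin_sub_one_ne_add_one hm k).symm, (fin_sub_one_ne_self hm k).symm,
      (fin_add_one_ne_self hm k).symm]
  rw [hl, hr, fk2, modelCoeff, modelCoeff]
  ring

theorem card_labelSupport_modelLabel_inl (k : Fin m) :
    (labelSupport (modelLabel (.inl k))).card = 2 := by
  rw [modelLabel, card_labelSupport_update, card_labelSupport_update, card_labelSupport_zero]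
  all_goals simp [(idx1_ne_idx2 _ _).symm]

theorem card_labelSupport_modelLabel_inr (hm : 3 ≤ m) (k : Fin m) :
    (labelSupport (modelLabel (.inr k))).card = 4 := by
  rw [modelLabel, card_labelSupport_update, card_labelSupport_update, card_labelSupport_update,
    card_labelSupport_update, card_labelSupport_zero]
  all_goals simp [(idx1_ne_idx2 _ _).symm, idx1_inj,
    (fin_sub_one_ne_add_one hm k).symm, (fin_sub_one_ne_self hm k).symm,
    (fin_add_one_ne_self hm k).symm]

end Cycle

theorem volume_box2m_toReal (m : ℕ) : (volume (box2m m)).toReal = (4 * π) ^ (2 * m) := by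
  have h : 2 * π - -(2 * π) = 4 * π := by ring
  rw [box2m, volume_pi_pi]
  simp only [Real.volume_Icc, h, Finset.prod_const, Finset.card_univ, Fintype.card_fin,
    ENNReal.toReal_pow]
  rw [ENNReal.toReal_ofReal (by positivity)]

/-- The average of the tangent kernel of the two-layer geometrically local circuit over
uniformly random parameters in `[−2π,2π]^{2m}`:
`E[K_Θ(x̂,x̂')] = (1/4m) ∑_k [2 cos x̂_k cos x̂'_k +
  cos x̂_{k−1} cos x̂_k cos x̂_{k+1} cos x̂'_{k−1} cos x̂'_k cos x̂'_{k+1}]`. -/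
theorem expected_tangent_kernel_two_layer
    {m : ℕ} [NeZero m] (hm : 3 ≤ m) (x x' : Fin m → ℝ) :
    (volume (box2m m)).toReal⁻¹ * ∫ Θ in box2m m, kernel2 Θ x x' =
      (1 / (4 * m)) * ∑ k : Fin m,
        (2 * Real.cos (x k) * Real.cos (x' k) +
          Real.cos (x (k - 1)) * Real.cos (x k) * Real.cos (x (k + 1)) *
            Real.cos (x' (k - 1)) * Real.cos (x' k) * Real.cos (x' (k + 1))) := by
  have hsq : (Real.sqrt m)⁻¹ * (Real.sqrt m)⁻¹ = (m : ℝ)⁻¹ := by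
    rw [← mul_inv, Real.mul_self_sqrt (Nat.cast_nonneg m)]
  simp_rw [kernel2, model2_eq_sum hm]
  rw [volume_box2m_toReal, box2m, setIntegral_sum_pder_mul_pder _ _ modelLabel_injective,
    inv_mul_cancel_left₀ (by positivity), Fintype.sum_sum_type, ← Finset.sum_add_distrib,
    Finset.mul_sum]
  refine Finset.sum_congr rfl fun k _ => ?_
  rw [card_labelSupport_modelLabel_inl, card_labelSupport_modelLabel_inr hm]
  simp only [modelCoeff, one_div, mul_inv]
  rw [← hsq]
  push_cast
  ring
end
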